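/- Let R be a non-negatively graded algebra over a local ring R_0 with dim R = d, let 𝔪 be the maximal homogeneous ideal of R, let M be a graded R-module, and let C_• : ⋯ → C_1 → C_0 → 0 be a homogeneous complex of finitely generated graded R-modules with H_0(C_•) = M. Fix an integer i with 0 ≤ i ≤ d and assume: (a) i + j + 1 ≤ depth C_j for all j with 0 ≤ j ≤ d − i − 1, and (b) dim H_j(C_•) ≤ j + i for all j ≥ 1. Then (1) the local cohomology module H^i_𝔪(M) is a graded subquotient of H^d_𝔪(C_{d−i}), and (2) a_i(M) ≤ b_0(C_{d−i}) + a(R). -/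

import Mathlib

/-!
Statement 0 (Lemma `localCoh` of the paper).

`R` is a non-negatively graded algebra over a local ring `R₀` (realized as the degree-zero
part `𝒜 0`), of Krull dimension `d`, with maximal homogeneous ideal `𝔪`; `M` is a graded
`R`-module and `C_•` a homogeneous complex of finitely generated graded `R`-modules with
`H₀(C_•) = M`.  Under the depth and dimension hypotheses (a), (b), the conclusions are:

(1) `H^i_𝔪(M)` is a subquotient of `H^d_𝔪(C_{d-i})` (local cohomology à la Mathlib), and
(2) `a_i(M) ≤ b₀(C_{d-i}) + a(R)`.

The graded pieces of local cohomology (needed for (2)) are expressed through the direct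
limit of Koszul cohomology on powers of a homogeneous generating system `y` of an ideal
with the same radical as `𝔪`; `KVanish y ℳ e i ℓ` says that the degree-`ℓ` piece of
`H^i_𝔪(M)` vanishes, and `GenDegLE ℳ β` says that a graded module is generated in
degrees `≤ β`.  The inequality (2) is stated in the equivalent universally quantified
form: for every upper bound `β` for `b₀(C_{d-i})` and every upper bound `γ` for `a(R)`,
the degree-`ℓ` piece of `H^i_𝔪(M)` vanishes for all `ℓ > β + γ`.
-/

open CategoryTheory

noncomputable section
namespace Paper

variable {R : Type} [CommRing R]

/-- The maximal homogeneous ideal of a non-negatively graded ring whose degree-zero part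
is local: it is generated by the nonunits of the degree-zero part together with all
homogeneous elements of nonzero degree. -/
def maxHomIdeal (𝒜 : ℤ → AddSubgroup R) [GradedRing 𝒜] : Ideal R :=
  Ideal.span ({ r : R | ∃ h : r ∈ 𝒜 0, ¬ IsUnit (⟨r, h⟩ : 𝒜 0) } ∪
    ⋃ (i : ℤ) (_ : i ≠ 0), (𝒜 i : Set R))

/-- A graded module is generated in degrees at most `b`; i.e. `b₀(M) ≤ b`. -/
def GenDegLE {M : Type} [AddCommGroup M] [Module R M] (ℳ : ℤ → AddSubgroup M) (b : ℤ) : Prop :=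
  Submodule.span R (⋃ (j : ℤ) (_ : j ≤ b), (ℳ j : Set M)) = ⊤

/-- `depth_I N ≥ k`: there is a regular sequence on `N` of length `k` inside `I`
(with the convention that the zero module has infinite depth). -/
def depthGE (I : Ideal R) (N : Type) [AddCommGroup N] [Module R N] (k : ℕ) : Prop :=
  Subsingleton N ∨ ∃ rs : List R, rs.length = k ∧ (∀ r ∈ rs, r ∈ I) ∧
    RingTheory.Sequence.IsRegular N rs

/-- `dim N ≤ b` for a module `N`: the Krull dimension of `R` modulo the annihilator. -/
def modDimLE (N : Type) [AddCommGroup N] [Module R N] (b : ℕ) : Prop :=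
  ringKrullDim (R ⧸ Module.annihilator R N) ≤ (b : WithBot (WithTop ℕ))

/-- `N` is a subquotient of `P`. -/
def IsSubquotient (N P : Type) [AddCommGroup N] [Module R N] [AddCommGroup P] [Module R P] :
    Prop :=
  ∃ (Q : Submodule R P) (Q' : Submodule R ↥Q), Nonempty ((↥Q ⧸ Q') ≃ₗ[R] N)

/-- Koszul cochains in cohomological degree `i` on `n` elements, with values in `M`. -/
abbrev KCochain (n : ℕ) (M : Type) (i : ℕ) : Type := {S : Finset (Fin n) // S.card = i} → M

variable {n : ℕ} (y : Fin n → R) {M : Type} [AddCommGroup M] [Module R M]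

/-- The Koszul cochain differential at stage `t` (Koszul cochains on `y₁ᵗ,…,yₙᵗ`). -/
def kd (t i : ℕ) (f : KCochain n M i) : KCochain n M (i + 1) := fun T =>
  ∑ j ∈ T.1.attach,
    ((-1 : ℤ) ^ ((T.1.filter (fun a => a < j.1)).card)) •
      ((y j.1 ^ t) • f ⟨T.1.erase j.1, by simp [Finset.card_erase_of_mem j.2, T.2]⟩)

/-- The transition map from stage `t` to stage `t + s` in the direct system of
Koszul cochain complexes. -/
def kTrans (s : ℕ) (i : ℕ) (f : KCochain n M i) : KCochain n M i := fun S =>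
  ((∏ j ∈ S.1, y j) ^ s) • f S

/-- `f` is a homogeneous cochain of internal degree `ℓ` at stage `t`, with respect to
a grading `ℳ` of `M`, the generators `y j` having degree `e j`. -/
def KHomog (ℳ : ℤ → AddSubgroup M) (e : Fin n → ℤ) (t : ℕ) (ℓ : ℤ) {i : ℕ}
    (f : KCochain n M i) : Prop :=
  ∀ S, f S ∈ ℳ (ℓ + (t : ℤ) * ∑ j ∈ S.1, e j)

/-- `f` is a coboundary at stage `t`. -/
def IsKBoundary (t : ℕ) : (i : ℕ) → KCochain n M i → Prop
  | 0, f => f = 0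
  | (i + 1), f => ∃ g : KCochain n M i, kd y t i g = f

/-- The degree-`ℓ` piece of the `i`-th graded local cohomology of `M` supported in the
ideal generated by the homogeneous elements `y` vanishes; local cohomology is computed
as the direct limit over `t` of the Koszul cohomology on `y₁ᵗ,…,yₙᵗ`. -/
def KVanish (ℳ : ℤ → AddSubgroup M) (e : Fin n → ℤ) (i : ℕ) (ℓ : ℤ) : Prop :=
  ∀ (t : ℕ) (f : KCochain n M i), kd y t i f = 0 → KHomog ℳ e t ℓ f →
    ∃ s : ℕ, IsKBoundary y (t + s) i (kTrans y s i f)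

/-- The homology module of a complex `C` in homological degree `j + 1`:
`ker (∂ⱼ : C_{j+1} → C_j) / im (∂_{j+1} : C_{j+2} → C_{j+1})`. -/
abbrev Hmod (C : ℕ → Type) [∀ j, AddCommGroup (C j)] [∀ j, Module R (C j)]
    (dl : ∀ j, C (j + 1) →ₗ[R] C j) (j : ℕ) : Type :=
  ↥(LinearMap.ker (dl j)) ⧸
    (Submodule.comap (LinearMap.ker (dl j)).subtype (LinearMap.range (dl (j + 1))))

section Koszul

/-- The sign with which the index `a` occurs in the Koszul differential at `S`. -/
def kSign (S : Finset (Fin n)) (a : Fin n) : ℤ := (-1) ^ (S.filter (fun b => b < a)).card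

lemma kSign_mul_self (S : Finset (Fin n)) (a : Fin n) : kSign S a * kSign S a = 1 := by
  rw [kSign, ← pow_add, ← two_mul, pow_mul]; simp

lemma kSign_erase {S : Finset (Fin n)} {a : Fin n} (ha : a ∈ S) (b : Fin n) :
    kSign (S.erase a) b = if a < b then - kSign S b else kSign S b := by
  rw [kSign, kSign, Finset.filter_erase]
  split_ifs with h
  · have hm : a ∈ S.filter (fun c => c < b) := by simp [ha, h]
    rw [← Finset.card_erase_add_one hm, pow_succ]; simp
  · rw [Finset.erase_eq_of_notMem (by simp [h])]

lemma kSign_insert {S : Finset (Fin n)} {a : Fin n} (ha : a ∉ S) (b : Fin n) :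
    kSign (insert a S) b = if a < b then - kSign S b else kSign S b := by
  have h := kSign_erase (Finset.mem_insert_self a S) b
  rw [Finset.erase_insert ha] at h
  rw [h]; split_ifs <;> simp

/-- Extension of a Koszul cochain by zero to all finite sets of indices. -/
def kExt {i : ℕ} (f : KCochain n M i) (S : Finset (Fin n)) : M :=
  if h : S.card = i then f ⟨S, h⟩ else 0

lemma kExt_coe {i : ℕ} (f : KCochain n M i) (S : {S : Finset (Fin n) // S.card = i}) :
    kExt f S.1 = f S := by
  rw [kExt, dif_pos S.2]

lemma kd_apply (t i : ℕ) (f : KCochain n M i) (T : {S : Finset (Fin n) // S.card = i + 1}) :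
    kd y t i f T = ∑ a ∈ T.1, kSign T.1 a • (y a ^ t • kExt f (T.1.erase a)) := by
  rw [kd, ← Finset.sum_attach T.1]
  refine Finset.sum_congr rfl fun a _ => ?_
  rw [kExt, dif_pos (by simp [Finset.card_erase_of_mem a.2, T.2])]
  rfl

lemma kd_kd (t i : ℕ) (f : KCochain n M i) : kd y t (i + 1) (kd y t i f) = 0 := by
  funext U
  rw [kd_apply, Pi.zero_apply]
  have h1 : ∀ a ∈ U.1, kSign U.1 a • (y a ^ t • kExt (kd y t i f) (U.1.erase a)) =
      ∑ b ∈ U.1.erase a, (kSign U.1 a * kSign (U.1.erase a) b) •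
        ((y a ^ t * y b ^ t) • kExt f ((U.1.erase a).erase b)) := by
    intro a ha
    have hc : (U.1.erase a).card = i + 1 := by simp [Finset.card_erase_of_mem ha, U.2]
    rw [kExt_coe _ ⟨U.1.erase a, hc⟩, kd_apply, Finset.smul_sum, Finset.smul_sum]
    refine Finset.sum_congr rfl fun b _ => ?_
    rw [smul_comm (y a ^ t), smul_smul, smul_smul]
  rw [Finset.sum_congr rfl h1, Finset.sum_sigma']
  refine Finset.sum_involution (fun x _ => ⟨x.2, x.1⟩) ?_ ?_ ?_ ?_
  · rintro ⟨a, b⟩ hab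
    simp only [Finset.mem_sigma, Finset.mem_erase] at hab
    obtain ⟨ha, hba, hb⟩ := hab
    simp only
    rw [kSign_erase ha, kSign_erase hb, Finset.erase_right_comm, mul_comm (y b ^ t), ← add_smul]
    convert zero_smul ℤ _
    rcases lt_or_gt_of_ne hba with h | h
    · rw [if_neg h.not_gt, if_pos h]; ring
    · rw [if_pos h, if_neg h.not_gt]; ring
  · rintro ⟨a, b⟩ hab _ h
    simp only [Finset.mem_sigma, Finset.mem_erase] at hab
    exact hab.2.1 (by simpa using congrArg Sigma.fst h)
  · rintro ⟨a, b⟩ hab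
    simp only [Finset.mem_sigma, Finset.mem_erase] at hab ⊢
    exact ⟨hab.2.2, hab.2.1.symm, hab.1⟩
  · rintro ⟨a, b⟩ _
    rfl

lemma kExt_map {N : Type} [AddCommGroup N] [Module R N] (φ : M →ₗ[R] N) {i : ℕ}
    (f : KCochain n M i) (S : Finset (Fin n)) :
    kExt (fun T => φ (f T) : KCochain n N i) S = φ (kExt f S) := by
  unfold kExt; split_ifs <;> simp

lemma kd_map {N : Type} [AddCommGroup N] [Module R N] (φ : M →ₗ[R] N) (t i : ℕ)
    (f : KCochain n M i) : kd y t i (fun T => φ (f T)) = fun T => φ (kd y t i f T) := by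
  funext T
  rw [kd_apply, kd_apply, map_sum]
  refine Finset.sum_congr rfl fun a _ => ?_
  rw [kExt_map, map_zsmul, map_smul]

lemma kd_add (t i : ℕ) (f g : KCochain n M i) : kd y t i (f + g) = kd y t i f + kd y t i g := by
  funext T
  simp only [kd, Pi.add_apply, smul_add, Finset.sum_add_distrib]

lemma kd_smul (t i : ℕ) (r : R) (f : KCochain n M i) : kd y t i (r • f) = r • kd y t i f :=
  kd_map y (LinearMap.lsmul R M r) t i f

lemma kd_sub (t i : ℕ) (f g : KCochain n M i) : kd y t i (f - g) = kd y t i f - kd y t i g := by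
  rw [sub_eq_add_neg, sub_eq_add_neg, kd_add, ← neg_one_smul R g, kd_smul, neg_one_smul]

lemma kd_zero (t i : ℕ) : kd y t i (0 : KCochain n M i) = 0 := by
  simpa using kd_smul y t i 0 (0 : KCochain n M i)

lemma kd_kTrans (t s i : ℕ) (f : KCochain n M i) :
    kd y (t + s) i (kTrans y s i f) = kTrans y s (i + 1) (kd y t i f) := by
  funext T
  rw [kTrans, kd_apply, kd_apply, Finset.smul_sum]
  refine Finset.sum_congr rfl fun a ha => ?_
  have hc : (T.1.erase a).card = i := by simp [Finset.card_erase_of_mem ha, T.2]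
  rw [kExt_coe _ ⟨_, hc⟩, kExt_coe _ ⟨_, hc⟩, kTrans, smul_smul, smul_comm _ (kSign T.1 a),
    smul_smul, ← Finset.mul_prod_erase T.1 y ha]
  congr 2
  ring

lemma kTrans_kTrans (s s' i : ℕ) (f : KCochain n M i) :
    kTrans y s' i (kTrans y s i f) = kTrans y (s + s') i f := by
  funext S
  rw [kTrans, kTrans, kTrans, smul_smul, ← pow_add, add_comm]

lemma kTrans_map {N : Type} [AddCommGroup N] [Module R N] (φ : M →ₗ[R] N) (s i : ℕ)
    (f : KCochain n M i) : kTrans y s i (fun T => φ (f T)) = fun T => φ (kTrans y s i f T) := by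
  funext T
  simp only [kTrans, map_smul]

lemma kTrans_smul (s i : ℕ) (r : R) (f : KCochain n M i) :
    kTrans y s i (r • f) = r • kTrans y s i f :=
  kTrans_map y (LinearMap.lsmul R M r) s i f

lemma kTrans_sub (s i : ℕ) (f g : KCochain n M i) :
    kTrans y s i (f - g) = kTrans y s i f - kTrans y s i g := by
  funext T
  simp only [kTrans, Pi.sub_apply, smul_sub]

lemma kTrans_zero (s i : ℕ) : kTrans y s i (0 : KCochain n M i) = 0 := by
  funext T
  simp only [kTrans, Pi.zero_apply, smul_zero]

variable {y}

lemma IsKBoundary.zero (t i : ℕ) : IsKBoundary y t i (0 : KCochain n M i) := by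
  cases i with
  | zero => rfl
  | succ i => exact ⟨0, kd_zero y t i⟩

lemma IsKBoundary.add {t i : ℕ} {f g : KCochain n M i} (hf : IsKBoundary y t i f)
    (hg : IsKBoundary y t i g) : IsKBoundary y t i (f + g) := by
  cases i with
  | zero =>
    change _ = _ at hf hg
    change _ = _
    rw [hf, hg, add_zero]
  | succ i =>
    obtain ⟨u, rfl⟩ := hf
    obtain ⟨v, rfl⟩ := hg
    exact ⟨u + v, kd_add y t i u v⟩

lemma IsKBoundary.map {N : Type} [AddCommGroup N] [Module R N] (φ : M →ₗ[R] N) {t i : ℕ}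
    {f : KCochain n M i} (hf : IsKBoundary y t i f) :
    IsKBoundary y t i (fun T => φ (f T) : KCochain n N i) := by
  cases i with
  | zero =>
    change _ = _ at hf
    change _ = _
    subst hf
    funext T
    simp
  | succ i =>
    obtain ⟨u, rfl⟩ := hf
    exact ⟨fun T => φ (u T), kd_map y φ t i u⟩

lemma IsKBoundary.smul {t i : ℕ} {f : KCochain n M i} (r : R) (hf : IsKBoundary y t i f) :
    IsKBoundary y t i (r • f) :=
  hf.map (LinearMap.lsmul R M r)

lemma IsKBoundary.kTrans {t i : ℕ} {f : KCochain n M i} (hf : IsKBoundary y t i f) (s : ℕ) :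
    IsKBoundary y (t + s) i (kTrans y s i f) := by
  cases i with
  | zero =>
    change _ = _ at hf
    change _ = _
    rw [hf, kTrans_zero]
  | succ i =>
    obtain ⟨u, rfl⟩ := hf
    exact ⟨Paper.kTrans y s i u, kd_kTrans y t s i u⟩

/-- The contraction of Koszul cochains with the basis vector of index `a`. -/
def kContract (a : Fin n) {i : ℕ} (f : KCochain n M (i + 1)) : KCochain n M i := fun S =>
  if a ∈ S.1 then 0 else kSign S.1 a • kExt f (insert a S.1)

lemma kExt_kContract (a : Fin n) {i : ℕ} (f : KCochain n M (i + 1)) (S : Finset (Fin n))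
    (hS : S.card = i) :
    kExt (kContract a f) S = if a ∈ S then 0 else kSign S a • kExt f (insert a S) := by
  rw [kExt_coe _ ⟨S, hS⟩]
  rfl

/-- Koszul cohomology at stage `t` is annihilated by the `t`-th powers of the generators. -/
lemma isKBoundary_pow_smul {t i : ℕ} {f : KCochain n M i} (hf : kd y t i f = 0) (a : Fin n) :
    IsKBoundary y t i (y a ^ t • f) := by
  cases i with
  | zero =>
    funext S
    have hS : S.1 = ∅ := Finset.card_eq_zero.1 S.2
    have h := congrFun hf ⟨{a}, by simp⟩
    rw [kd_apply] at h
    simp only [Finset.sum_singleton, Finset.erase_singleton, Pi.zero_apply] at h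
    rw [← hS, kExt_coe, kSign, Finset.filter_singleton, if_neg (lt_irrefl a)] at h
    simpa using h
  | succ i =>
    refine ⟨kContract a f, ?_⟩
    funext T
    have hcard : ∀ b ∈ T.1, (T.1.erase b).card = i := fun b hb => by
      simp [Finset.card_erase_of_mem hb, T.2]
    rw [kd_apply, Pi.smul_apply]
    by_cases ha : a ∈ T.1
    · rw [Finset.sum_eq_single_of_mem a ha]
      · rw [kExt_kContract _ _ _ (hcard a ha), if_neg (Finset.notMem_erase a _),
          Finset.insert_erase ha, kExt_coe, kSign_erase ha, if_neg (lt_irrefl a),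
          smul_comm (y a ^ t), smul_smul, kSign_mul_self, one_smul]
      · intro b hb hba
        rw [kExt_kContract _ _ _ (hcard b hb), if_pos (by simp [ha, hba.symm]), smul_zero,
          smul_zero]
    · have h := congrFun hf ⟨insert a T.1, by rw [Finset.card_insert_of_notMem ha, T.2]⟩
      rw [kd_apply, Finset.sum_insert ha, Finset.erase_insert ha, kSign_insert ha,
        if_neg (lt_irrefl a), kExt_coe, Pi.zero_apply] at h
      have h2 : ∀ b ∈ T.1, kSign T.1 b • y b ^ t • kExt (kContract a f) (T.1.erase b) =
          -(kSign T.1 a • (kSign (insert a T.1) b • y b ^ t •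
            kExt f ((insert a T.1).erase b))) := by
        intro b hb
        have hba : b ≠ a := fun h => ha (h ▸ hb)
        rw [kExt_kContract _ _ _ (hcard b hb), if_neg (by simp [ha]),
          Finset.erase_insert_of_ne hba.symm, smul_comm (y b ^ t), smul_smul, smul_smul,
          ← neg_smul, kSign_insert ha, kSign_erase hb]
        congr 1
        rcases lt_or_gt_of_ne hba with h | h
        · rw [if_pos h, if_neg h.not_gt]; ring
        · rw [if_neg h.not_gt, if_pos h]; ring
      rw [Finset.sum_congr rfl h2, Finset.sum_neg_distrib, ← Finset.smul_sum,
        eq_neg_of_add_eq_zero_right h, smul_neg, neg_neg, smul_smul, kSign_mul_self, one_smul]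

lemma exists_isKBoundary_pow_smul {t i : ℕ} {f : KCochain n M i} (hf : kd y t i f = 0) {r : R}
    (hr : r ∈ (Ideal.span (Set.range y)).radical) :
    ∃ k : ℕ, IsKBoundary y t i (r ^ k • f) := by
  have h1 : Ideal.span (Set.range y) ≤ (Ideal.span (Set.range fun a => y a ^ t)).radical := by
    rw [Ideal.span_le]
    rintro _ ⟨a, rfl⟩
    exact ⟨t, Ideal.subset_span ⟨a, rfl⟩⟩
  obtain ⟨k, hk⟩ := Ideal.radical_le_radical_iff.2 h1 hr
  refine ⟨k, ?_⟩
  refine Submodule.span_induction (p := fun x _ => IsKBoundary y t i (x • f)) ?_ ?_ ?_ ?_ hk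
  · rintro _ ⟨a, rfl⟩
    exact isKBoundary_pow_smul hf a
  · rw [zero_smul]
    exact IsKBoundary.zero t i
  · intro x z _ _ hx hz
    rw [add_smul]
    exact hx.add hz
  · intro x z _ hz
    rw [smul_eq_mul, mul_smul]
    exact hz.smul x

end Koszul

/-- The formal properties of the vanishing of cohomology supported in `I` from which the depth
and dimension bounds follow. -/
structure IsVanishing (I : Ideal R)
    (V : ℕ → (N : Type) → [AddCommGroup N] → [Module R N] → Prop) : Prop where
  subsingleton : ∀ (j : ℕ) (N : Type) [AddCommGroup N] [Module R N], Subsingleton N → V j N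
  regular_zero : ∀ (N : Type) [AddCommGroup N] [Module R N] (r : R), r ∈ I →
    IsSMulRegular N r → V 0 N
  regular_succ : ∀ (j : ℕ) (N : Type) [AddCommGroup N] [Module R N] (r : R), r ∈ I →
    IsSMulRegular N r → V j (QuotSMulTop r N) → V (j + 1) N
  exact : ∀ (j : ℕ) (N₁ N₂ N₃ : Type) [AddCommGroup N₁] [Module R N₁] [AddCommGroup N₂]
    [Module R N₂] [AddCommGroup N₃] [Module R N₃] (f : N₁ →ₗ[R] N₂) (g : N₂ →ₗ[R] N₃),
    Function.Injective f → Function.Surjective g → Function.Exact f g →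
    V j N₁ → V j N₃ → V j N₂
  torsion : ∀ (j : ℕ) (N : Type) [AddCommGroup N] [Module R N],
    (∀ r ∈ I, ∀ x : N, r • x = 0) → V (j + 1) N

section Vanishing

variable {I : Ideal R} {V : ℕ → (N : Type) → [AddCommGroup N] → [Module R N] → Prop}

lemma IsVanishing.of_isWeaklyRegular (hV : IsVanishing I V) (rs : List R) :
    ∀ (N : Type) [AddCommGroup N] [Module R N], (∀ r ∈ rs, r ∈ I) →
      RingTheory.Sequence.IsWeaklyRegular N rs → ∀ j < rs.length, V j N := by
  induction rs with
  | nil => intro N _ _ _ _ j hj; simp at hj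
  | cons r rs ih =>
    intro N _ _ hmem hreg j hj
    rw [RingTheory.Sequence.isWeaklyRegular_cons_iff] at hreg
    cases j with
    | zero => exact hV.regular_zero N r (hmem r (by simp)) hreg.1
    | succ j =>
      refine hV.regular_succ j N r (hmem r (by simp)) hreg.1 ?_
      exact ih _ (fun s hs => hmem s (by simp [hs])) hreg.2 j (by simpa using hj)

/-- Cohomology vanishes below the depth. -/
lemma IsVanishing.of_depthGE (hV : IsVanishing I V) (N : Type) [AddCommGroup N] [Module R N]
    {k j : ℕ} (hN : depthGE I N k) (hj : j < k) : V j N := by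
  rcases hN with h | ⟨rs, rfl, hmem, hreg⟩
  · exact hV.subsingleton j N h
  · exact hV.of_isWeaklyRegular rs N hmem hreg.toIsWeaklyRegular j hj

lemma lt_of_add_one_lt_succ {a : WithBot ℕ∞} {j : ℕ} (h : a + 1 < ((j + 1 : ℕ) : WithBot ℕ∞)) :
    a < (j : WithBot ℕ∞) := by
  induction a with
  | bot => exact WithBot.bot_lt_coe _
  | coe a =>
    have h' : a + 1 < ((j + 1 : ℕ) : ℕ∞) := WithBot.coe_lt_coe.1 h
    refine WithBot.coe_lt_coe.2 ?_
    induction a with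
    | top => simp at h'
    | coe a =>
      have h'' : a + 1 < j + 1 := by exact_mod_cast h'
      exact_mod_cast Nat.lt_of_succ_lt_succ h''

/-- Grothendieck vanishing: cohomology vanishes above the dimension. -/
lemma IsVanishing.of_supportDim_lt [IsNoetherianRing R] (hV : IsVanishing I V) (j : ℕ) :
    ∀ (N : Type) [AddCommGroup N] [Module R N] [Module.Finite R N],
      Module.supportDim R N < (j : WithBot ℕ∞) → V j N := by
  induction j with
  | zero =>
    intro N _ _ _ h
    refine hV.subsingleton 0 N ?_
    by_contra hN
    rw [not_subsingleton_iff_nontrivial] at hN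
    obtain ⟨x, hx⟩ := WithBot.ne_bot_iff_exists.1 (Module.supportDim_ne_bot_of_nontrivial R N)
    rw [← hx] at h
    exact absurd (WithBot.coe_lt_coe.1 h) not_lt_zero
  | succ j ih =>
    intro N _ _ hfin
    induction hfin using IsNoetherianRing.induction_on_isQuotientEquivQuotientPrime with
    | subsingleton N => exact fun _ => hV.subsingleton _ N inferInstance
    | quotient N p e =>
      intro hN
      by_cases hp : I ≤ p.1
      · refine hV.torsion j N fun r hr x => e.injective ?_
        rw [map_smul, map_zero]
        obtain ⟨y, hy⟩ := Ideal.Quotient.mk_surjective (e x)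
        rw [← hy, ← Ideal.Quotient.mk_eq_mk, ← Submodule.Quotient.mk_smul,
          Submodule.Quotient.mk_eq_zero]
        exact p.1.mul_mem_right _ (hp hr)
      · obtain ⟨r, hr, hrp⟩ := Set.not_subset.1 hp
        have hann : Module.annihilator R N = p.1 := by
          rw [e.annihilator_eq, Ideal.annihilator_quotient]
        have hreg : IsSMulRegular N r := by
          rw [isSMulRegular_iff_right_eq_zero_of_smul]
          intro x hx
          apply e.injective
          obtain ⟨y, hy⟩ := Ideal.Quotient.mk_surjective (e x)
          have h1 : r • e x = 0 := by rw [← map_smul, hx, map_zero]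
          rw [← hy, ← Ideal.Quotient.mk_eq_mk, ← Submodule.Quotient.mk_smul,
            Submodule.Quotient.mk_eq_zero] at h1
          rw [map_zero, ← hy, Ideal.Quotient.eq_zero_iff_mem]
          exact (p.2.mem_or_mem h1).resolve_left hrp
        refine hV.regular_succ j N r hr hreg (ih _ ?_)
        have h1 := Module.supportDim_quotSMulTop_succ_le_of_notMem_minimalPrimes (R := R)
          (M := N) (x := r) (by
            intro q hq
            rw [hann, Ideal.minimalPrimes_eq_subsingleton_self] at hq
            rw [Set.mem_singleton_iff.1 hq]
            exact hrp)
        exact lt_of_add_one_lt_succ (h1.trans_lt hN)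
    | exact N₁ N₂ N₃ f g hf hg hfg h₁ h₃ =>
      intro hN
      exact hV.exact _ _ _ _ f g hf hg hfg
        (h₁ ((Module.supportDim_le_of_injective f hf).trans_lt hN))
        (h₃ ((Module.supportDim_le_of_surjective g hg).trans_lt hN))

lemma IsVanishing.of_modDimLE [IsNoetherianRing R] (hV : IsVanishing I V) (N : Type)
    [AddCommGroup N] [Module R N] [Module.Finite R N] {b j : ℕ} (hN : modDimLE (R := R) N b)
    (hj : b < j) : V j N := by
  refine hV.of_supportDim_lt j N ?_
  rw [Module.supportDim_eq_ringKrullDim_quotient_annihilator]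
  exact lt_of_le_of_lt hN (WithBot.coe_lt_coe.2 (ENat.natCast_lt_natCast.2 hj))

lemma IsVanishing.of_ringKrullDim_lt [IsNoetherianRing R] (hV : IsVanishing I V) (N : Type)
    [AddCommGroup N] [Module R N] [Module.Finite R N] {d j : ℕ}
    (hd : ringKrullDim R = (d : WithBot (WithTop ℕ))) (hj : d < j) : V j N := by
  refine hV.of_supportDim_lt j N ((Module.supportDim_le_ringKrullDim R N).trans_lt ?_)
  rw [hd]
  exact WithBot.coe_lt_coe.2 (ENat.natCast_lt_natCast.2 hj)

end Vanishing

section KoszulVanishing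

/-- The `i`-th local cohomology of `M` (as the colimit of Koszul cohomology) vanishes. -/
def KVanishAll (i : ℕ) (M : Type) [AddCommGroup M] [Module R M] : Prop :=
  ∀ (t : ℕ) (f : KCochain n M i), kd y t i f = 0 → ∃ s : ℕ, IsKBoundary y (t + s) i (kTrans y s i f)

/-- The maps `p ℓ` are projections onto the subgroups `ℳ ℓ` which are compatible with
multiplication by the elements `y a`, homogeneous of degrees `e a`. -/
structure IsProjections (e : Fin n → ℤ) (ℳ : ℤ → AddSubgroup M) (p : ℤ → M →+ M) : Prop where
  mem : ∀ ℓ x, p ℓ x ∈ ℳ ℓ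
  eq_self : ∀ ℓ, ∀ x ∈ ℳ ℓ, p ℓ x = x
  smul : ∀ a ℓ x, p (ℓ + e a) (y a • x) = y a • p ℓ x

variable {y} {e : Fin n → ℤ} {ℳ : ℤ → AddSubgroup M} {p : ℤ → M →+ M}

lemma isProjections_top : IsProjections y e (fun _ => (⊤ : AddSubgroup M)) fun _ =>
    AddMonoidHom.id M :=
  ⟨fun _ _ => trivial, fun _ _ _ => rfl, fun _ _ _ => rfl⟩

/-- Componentwise projection of a cochain at stage `t` onto its part of degree `ℓ`. -/
def kProj (e : Fin n → ℤ) (p : ℤ → M →+ M) (t : ℕ) (ℓ : ℤ) {i : ℕ} (f : KCochain n M i) :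
    KCochain n M i :=
  fun S => p (ℓ + (t : ℤ) * ∑ j ∈ S.1, e j) (f S)

lemma kProj_sub (t : ℕ) (ℓ : ℤ) {i : ℕ} (f g : KCochain n M i) :
    kProj e p t ℓ (f - g) = kProj e p t ℓ f - kProj e p t ℓ g := by
  funext S
  simp [kProj]

lemma kExt_kProj (t : ℕ) (ℓ : ℤ) {i : ℕ} (f : KCochain n M i) (S : Finset (Fin n)) :
    kExt (kProj e p t ℓ f) S = p (ℓ + (t : ℤ) * ∑ j ∈ S, e j) (kExt f S) := by
  unfold kExt
  split_ifs
  · rfl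
  · rw [map_zero]

namespace IsProjections

variable (hp : IsProjections y e ℳ p)
include hp

lemma pow_smul (a : Fin n) (ℓ : ℤ) (t : ℕ) (x : M) :
    p (ℓ + t * e a) (y a ^ t • x) = y a ^ t • p ℓ x := by
  induction t with
  | zero => simp
  | succ t ih =>
    rw [pow_succ', mul_smul, mul_smul, ← ih, ← hp.smul]
    congr 2
    push_cast
    ring

lemma prod_pow_smul (S : Finset (Fin n)) (t : ℕ) (x : M) (ℓ : ℤ) :
    p (ℓ + t * ∑ a ∈ S, e a) ((∏ a ∈ S, y a) ^ t • x) = (∏ a ∈ S, y a) ^ t • p ℓ x := by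
  induction S using Finset.induction_on generalizing ℓ with
  | empty => simp
  | insert a S ha ih =>
    rw [Finset.prod_insert ha, Finset.sum_insert ha, mul_pow, mul_smul, mul_smul, ← ih,
      ← hp.pow_smul]
    congr 2
    ring

lemma kd_kProj (t : ℕ) (ℓ : ℤ) (i : ℕ) (f : KCochain n M i) :
    kd y t i (kProj e p t ℓ f) = kProj e p t ℓ (kd y t i f) := by
  funext T
  rw [kProj, kd_apply, kd_apply, map_sum]
  refine Finset.sum_congr rfl fun a ha => ?_
  rw [map_zsmul, kExt_kProj, ← hp.pow_smul, ← Finset.add_sum_erase T.1 e ha]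
  congr 3
  ring

lemma kTrans_kProj (t s : ℕ) (ℓ : ℤ) (i : ℕ) (f : KCochain n M i) :
    kTrans y s i (kProj e p t ℓ f) = kProj e p (t + s) ℓ (kTrans y s i f) := by
  funext T
  rw [kTrans, kProj, kProj, kTrans, ← hp.prod_pow_smul]
  congr 2
  push_cast
  ring

lemma kProj_eq {t : ℕ} {ℓ : ℤ} {i : ℕ} {f : KCochain n M i} (hf : KHomog ℳ e t ℓ f) :
    kProj e p t ℓ f = f := by
  funext S
  exact hp.eq_self _ _ (hf S)

lemma kHomog_kProj (t : ℕ) (ℓ : ℤ) {i : ℕ} (f : KCochain n M i) :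
    KHomog ℳ e t ℓ (kProj e p t ℓ f) := fun _ => hp.mem _ _

lemma kHomog_kd {t : ℕ} {ℓ : ℤ} {i : ℕ} {f : KCochain n M i} (hf : KHomog ℳ e t ℓ f) :
    KHomog ℳ e t ℓ (kd y t i f) := by
  rw [← hp.kProj_eq hf, hp.kd_kProj]
  exact hp.kHomog_kProj _ _ _

lemma kHomog_kTrans {t : ℕ} {ℓ : ℤ} {i : ℕ} {f : KCochain n M i} (hf : KHomog ℳ e t ℓ f)
    (s : ℕ) : KHomog ℳ e (t + s) ℓ (kTrans y s i f) := by
  rw [← hp.kProj_eq hf, hp.kTrans_kProj]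
  exact hp.kHomog_kProj _ _ _

end IsProjections

lemma KHomog.sub {t : ℕ} {ℓ : ℤ} {i : ℕ} {f g : KCochain n M i} (hf : KHomog ℳ e t ℓ f)
    (hg : KHomog ℳ e t ℓ g) : KHomog ℳ e t ℓ (f - g) := fun S => (ℳ _).sub_mem (hf S) (hg S)

section Exact

variable {A B C : Type} [AddCommGroup A] [Module R A] [AddCommGroup B] [Module R B]
  [AddCommGroup C] [Module R C] {f : A →ₗ[R] B} {g : B →ₗ[R] C}
  {𝒜 : ℤ → AddSubgroup A} {ℬ : ℤ → AddSubgroup B} {𝒞 : ℤ → AddSubgroup C}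
  {pA : ℤ → A →+ A} {pB : ℤ → B →+ B}

lemma exists_cochain_lift (hfg : Function.Exact f g) {i : ℕ} (u : KCochain n B i)
    (hu : (fun S => g (u S)) = (0 : KCochain n C i)) :
    ∃ v : KCochain n A i, (fun S => f (v S)) = u := by
  choose v hv using fun S => (hfg (u S)).1 (congrFun hu S)
  exact ⟨v, funext hv⟩

lemma cochain_map_injective (hf : Function.Injective f) {i : ℕ} {u v : KCochain n A i}
    (h : (fun S => f (u S)) = (fun S => f (v S) : KCochain n B i)) : u = v :=
  funext fun S => hf (congrFun h S)

/-- If the cohomology of the middle term vanishes in degree `j`, the connecting map in degree `j`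
is injective. -/
lemma KVanish.of_middle (hf : Function.Injective f) (hfg : Function.Exact f g)
    (hB : IsProjections y e ℬ pB) (hA : ∀ ℓ x, f x ∈ ℬ ℓ → x ∈ 𝒜 ℓ)
    (hC : ∀ ℓ, ∀ z ∈ 𝒞 ℓ, ∃ x ∈ ℬ ℓ, g x = z) {j : ℕ} {ℓ : ℤ} (hv : KVanishAll y j B)
    (h : KVanish y 𝒜 e (j + 1) ℓ) : KVanish y 𝒞 e j ℓ := by
  intro t w hw hwh
  choose x hx hxw using fun S => hC _ _ (hwh S)
  obtain ⟨u, hu⟩ := exists_cochain_lift hfg (kd y t j x) (by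
    rw [← kd_map, funext hxw, hw])
  have hu0 : kd y t (j + 1) u = 0 := cochain_map_injective hf (by
    rw [← kd_map, hu, kd_kd]
    funext S
    simp)
  have huh : KHomog 𝒜 e t ℓ u := fun S => hA _ _ (by
    rw [congrFun hu S]
    exact hB.kHomog_kd hx S)
  obtain ⟨s, v, hvu⟩ := h t u hu0 huh
  obtain ⟨s', hs'⟩ := hv (t + s) (kTrans y s j x - fun S => f (v S)) (by
    rw [kd_sub, kd_kTrans, kd_map, hvu, ← hu, kTrans_map, sub_self])
  refine ⟨s + s', ?_⟩
  have h1 := hs'.map g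
  rw [← kTrans_map] at h1
  have h2 : (fun T => g ((kTrans y s j x - fun S => f (v S)) T)) = kTrans y s j w := by
    rw [← (funext hxw : (fun S => g (x S)) = w), kTrans_map]
    funext T
    simp [hfg.apply_apply_eq_zero]
  rwa [h2, kTrans_kTrans, add_assoc] at h1

/-- If the cohomology of the quotient vanishes in degree `j`, the map induced by the inclusion
is surjective in degree `j`. -/
lemma KVanish.of_quotient (hf : Function.Injective f) (hg : Function.Surjective g)
    (hfg : Function.Exact f g) (hB : IsProjections y e ℬ pB) (hA : ∀ ℓ x, f x ∈ ℬ ℓ → x ∈ 𝒜 ℓ)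
    (hp : ∀ ℓ x, f (pA ℓ x) = pB ℓ (f x)) {j : ℕ} {ℓ : ℤ} (hv : KVanishAll y j C)
    (h : KVanish y 𝒜 e j ℓ) : KVanish y ℬ e j ℓ := by
  intro t w hw hwh
  obtain ⟨s, hs⟩ := hv t (fun S => g (w S)) (by
    rw [kd_map, hw]
    funext S
    simp)
  rw [kTrans_map] at hs
  have key : ∃ b : KCochain n B j, IsKBoundary y (t + s) j b ∧ KHomog ℬ e (t + s) ℓ b ∧
      ∃ u : KCochain n A j, (fun S => f (u S)) = kTrans y s j w - b := by
    cases j with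
    | zero =>
      obtain ⟨u, hu⟩ := exists_cochain_lift hfg _ hs
      exact ⟨0, rfl, fun S => (ℬ _).zero_mem, u, by rw [hu, sub_zero]⟩
    | succ j =>
      obtain ⟨v, hv⟩ := hs
      choose x hx using fun S => hg (v S)
      obtain ⟨u, hu⟩ := exists_cochain_lift hfg (kTrans y s (j + 1) w - kd y (t + s) j x) (by
        have h1 := kd_map y g (t + s) j x
        rw [funext hx, hv] at h1
        funext S
        simpa [sub_eq_zero] using congrFun h1 S)
      refine ⟨kd y (t + s) j (kProj e pB (t + s) ℓ x), ⟨_, rfl⟩,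
        hB.kHomog_kd (hB.kHomog_kProj _ _ _), kProj e pA (t + s) ℓ u, ?_⟩
      rw [hB.kd_kProj, ← hB.kProj_eq (hB.kHomog_kTrans hwh s), ← kProj_sub, ← hu]
      funext S
      exact hp _ _
  obtain ⟨b, hb, hbh, u, hu⟩ := key
  have hb0 : kd y (t + s) j b = 0 := by
    cases j with
    | zero =>
      change _ = _ at hb
      rw [hb, kd_zero]
    | succ j =>
      obtain ⟨v, rfl⟩ := hb
      exact kd_kd _ _ _ _
  obtain ⟨s', hs'⟩ := h (t + s) u
    (cochain_map_injective hf (by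
      rw [← kd_map, hu, kd_sub, hb0, kd_kTrans, hw, kTrans_zero, sub_zero]
      funext S
      simp))
    (fun S => hA _ _ (by
      rw [congrFun hu S]
      exact (hB.kHomog_kTrans hwh s).sub hbh S))
  refine ⟨s + s', ?_⟩
  have h1 := (hs'.map f).add (hb.kTrans s')
  rw [← kTrans_map, hu, kTrans_sub, sub_add_cancel, kTrans_kTrans, add_assoc] at h1
  exact h1

/-- If the cohomology of the submodule vanishes in degree `j + 1`, the map induced by the
projection is surjective in degree `j`. -/
lemma KVanish.of_sub (hf : Function.Injective f)
    (hfg : Function.Exact f g) (hA : IsProjections y e 𝒜 pA) (hB : IsProjections y e ℬ pB)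
    (hAB : ∀ ℓ x, f x ∈ ℬ ℓ ↔ x ∈ 𝒜 ℓ)
    (hC : ∀ ℓ, ∀ z ∈ 𝒞 ℓ, ∃ x ∈ ℬ ℓ, g x = z) {j : ℕ} {ℓ : ℤ} (hv : KVanishAll y (j + 1) A)
    (h : KVanish y ℬ e j ℓ) : KVanish y 𝒞 e j ℓ := by
  intro t w hw hwh
  choose x hx hxw using fun S => hC _ _ (hwh S)
  obtain ⟨u, hu⟩ := exists_cochain_lift hfg (kd y t j x) (by
    rw [← kd_map, funext hxw, hw])
  have hu0 : kd y t (j + 1) u = 0 := cochain_map_injective hf (by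
    rw [← kd_map, hu, kd_kd]
    funext S
    simp)
  have huh : KHomog 𝒜 e t ℓ u := fun S => (hAB _ _).1 (by
    rw [congrFun hu S]
    exact hB.kHomog_kd hx S)
  obtain ⟨s, v, hvu⟩ := hv t u hu0
  have hvu' : kd y (t + s) j (kProj e pA (t + s) ℓ v) = kTrans y s (j + 1) u := by
    rw [hA.kd_kProj, hvu, hA.kProj_eq (hA.kHomog_kTrans huh s)]
  obtain ⟨s', hs'⟩ := h (t + s) (kTrans y s j x - fun S => f (kProj e pA (t + s) ℓ v S))
    (by rw [kd_sub, kd_kTrans, kd_map, hvu', ← hu, kTrans_map, sub_self])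
    ((hB.kHomog_kTrans hx s).sub fun S => (hAB _ _).2 (hA.kHomog_kProj _ _ _ S))
  refine ⟨s + s', ?_⟩
  have h1 := hs'.map g
  rw [← kTrans_map] at h1
  have h2 : (fun T => g ((kTrans y s j x - fun S => f (kProj e pA (t + s) ℓ v S)) T)) =
      kTrans y s j w := by
    rw [← (funext hxw : (fun S => g (x S)) = w), kTrans_map]
    funext T
    simp [hfg.apply_apply_eq_zero]
  rwa [h2, kTrans_kTrans, add_assoc] at h1

end Exact

lemma kVanish_top_iff {j : ℕ} {ℓ : ℤ} :
    KVanish y (fun _ => (⊤ : AddSubgroup M)) e j ℓ ↔ KVanishAll y j M :=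
  ⟨fun h t f hf => h t f hf fun _ => trivial, fun h t f hf _ => h t f hf⟩

open scoped Pointwise in
/-- Koszul cohomology vanishing satisfies the formal properties of local cohomology. -/
lemma isVanishing_kVanishAll {I : Ideal R} (hI : (Ideal.span (Set.range y)).radical = I.radical) :
    IsVanishing I (fun j N _ _ => KVanishAll y j N) where
  subsingleton j N _ _ _ := by
    intro t f _
    refine ⟨0, ?_⟩
    rw [Subsingleton.elim (kTrans y 0 j f) 0]
    exact IsKBoundary.zero _ _
  regular_zero N _ _ r hr hreg := by
    intro t f hf
    obtain ⟨k, hk⟩ := exists_isKBoundary_pow_smul hf (r := r) (hI ▸ Ideal.le_radical hr)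
    refine ⟨0, ?_⟩
    have : f = 0 := by
      funext S
      refine (hreg.pow k) ?_
      change r ^ k • f S = r ^ k • (0 : N)
      rw [smul_zero]
      exact congrFun hk S
    rw [this, kTrans_zero]
    exact IsKBoundary.zero _ _
  regular_succ j N _ _ r hr hreg hv := by
    have step : ∀ (t : ℕ) (f : KCochain n N (j + 1)), IsKBoundary y t (j + 1) (r • f) →
        ∃ s, IsKBoundary y (t + s) (j + 1) (kTrans y s (j + 1) f) := by
      rintro t f ⟨g, hg⟩
      obtain ⟨s, hs⟩ := hv t (fun S => (r • (⊤ : Submodule R N)).mkQ (g S)) (by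
        rw [kd_map, hg]
        funext S
        change (r • (⊤ : Submodule R N)).mkQ (r • f S) = 0
        rw [Submodule.mkQ_apply, Submodule.Quotient.mk_eq_zero]
        exact Submodule.smul_mem_pointwise_smul _ _ _ trivial)
      have hex : Function.Exact (LinearMap.lsmul R N r) (r • (⊤ : Submodule R N)).mkQ := by
        intro x
        rw [Submodule.mkQ_apply, Submodule.Quotient.mk_eq_zero,
          Submodule.mem_smul_pointwise_iff_exists]
        simp
      have key : ∃ b : KCochain n N j, kd y (t + s) j b = 0 ∧
          ∃ u : KCochain n N j, r • u = kTrans y s j g - b := by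
        rw [kTrans_map] at hs
        cases j with
        | zero =>
          obtain ⟨u, hu⟩ := exists_cochain_lift hex _ hs
          exact ⟨0, kd_zero _ _ _, u, by rw [sub_zero]; exact hu⟩
        | succ j =>
          obtain ⟨v, hv⟩ := hs
          choose x hx using fun S => Submodule.mkQ_surjective (r • (⊤ : Submodule R N)) (v S)
          obtain ⟨u, hu⟩ := exists_cochain_lift hex
            (kTrans y s (j + 1) g - kd y (t + s) j x) (by
              have h1 := kd_map y (r • (⊤ : Submodule R N)).mkQ (t + s) j x
              rw [funext hx, hv] at h1
              funext S
              rw [Pi.sub_apply, map_sub, Pi.zero_apply, sub_eq_zero]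
              exact congrFun h1 S)
          exact ⟨kd y (t + s) j x, kd_kd _ _ _ _, u, hu⟩
      obtain ⟨b, hb, u, hu⟩ := key
      refine ⟨s, u, ?_⟩
      have h1 : r • kd y (t + s) j u = r • kTrans y s (j + 1) f := by
        rw [← kd_smul, hu, kd_sub, hb, sub_zero, kd_kTrans, hg, kTrans_smul]
      funext S
      exact hreg (congrFun h1 S)
    have iter : ∀ (k t : ℕ) (f : KCochain n N (j + 1)), IsKBoundary y t (j + 1) (r ^ k • f) →
        ∃ s, IsKBoundary y (t + s) (j + 1) (kTrans y s (j + 1) f) := by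
      intro k
      induction k with
      | zero =>
        intro t f hf
        rw [pow_zero, one_smul] at hf
        exact ⟨0, hf.kTrans 0⟩
      | succ k ih =>
        intro t f hf
        rw [pow_succ', mul_smul] at hf
        obtain ⟨s, hs⟩ := step t _ hf
        rw [kTrans_smul] at hs
        obtain ⟨s', hs'⟩ := ih _ _ hs
        rw [kTrans_kTrans, add_assoc] at hs'
        exact ⟨_, hs'⟩
    intro t f hf
    obtain ⟨k, hk⟩ := exists_isKBoundary_pow_smul hf (r := r) (hI ▸ Ideal.le_radical hr)
    exact iter k t f hk
  exact j N₁ N₂ N₃ _ _ _ _ _ _ f g hf hg hfg h₁ h₃ := by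
    rw [← kVanish_top_iff (e := 0) (ℓ := 0)] at h₁ ⊢
    exact KVanish.of_quotient (𝒜 := fun _ => ⊤)
      (pA := fun _ => AddMonoidHom.id N₁) hf hg hfg isProjections_top
      (fun _ _ _ => trivial) (fun _ _ => rfl) h₃ h₁
  torsion j N _ _ h := by
    intro t f _
    have hy : ∀ a, ∃ k, y a ^ k ∈ I := fun a => by
      have : y a ∈ I.radical := hI ▸ Ideal.le_radical (Ideal.subset_span ⟨a, rfl⟩)
      exact this
    choose k hk using hy
    refine ⟨∑ a, k a, ?_⟩
    convert IsKBoundary.zero _ _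
    funext S
    obtain ⟨a, ha⟩ : S.1.Nonempty := Finset.card_pos.1 (by omega)
    refine h _ ?_ _
    rw [← Finset.mul_prod_erase S.1 y ha, mul_pow]
    refine I.mul_mem_right _ (I.pow_mem_of_pow_mem (hk a) ?_)
    exact Finset.single_le_sum (fun _ _ => Nat.zero_le _) (Finset.mem_univ a)

end KoszulVanishing


section LocalCohomology

open CategoryTheory.Abelian CategoryTheory.Limits

variable (I : Ideal R)

/-- The quotient map `R / I ^ m → R / I ^ n` for `n ≤ m`. -/
def powQuot {n m : ℕ} (h : n ≤ m) : ModuleCat.of R (R ⧸ I ^ m) ⟶ ModuleCat.of R (R ⧸ I ^ n) :=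
  ModuleCat.ofHom (Submodule.mapQ _ _ LinearMap.id (Ideal.pow_le_pow_right h))

lemma powQuot_refl (n : ℕ) : powQuot I (le_refl n) = 𝟙 _ := by
  refine ModuleCat.hom_ext (LinearMap.ext fun x => ?_)
  obtain ⟨x, rfl⟩ := Ideal.Quotient.mk_surjective x
  rfl

lemma powQuot_comp {n m k : ℕ} (h : n ≤ m) (h' : m ≤ k) :
    powQuot I h' ≫ powQuot I h = powQuot I (h.trans h') := by
  refine ModuleCat.hom_ext (LinearMap.ext fun x => ?_)
  obtain ⟨x, rfl⟩ := Ideal.Quotient.mk_surjective x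
  rfl

/-- The `R`-module `Ext^j(R / I ^ n, N)`. -/
abbrev PowExt (j : ℕ) (N : ModuleCat.{0} R) (n : ℕ) : Type :=
  Ext (ModuleCat.of R (R ⧸ I ^ n)) N j

/-- The transition maps of the direct system `Ext^j(R / I ^ n, N)`. -/
abbrev powExtMap (j : ℕ) (N : ModuleCat.{0} R) (n m : ℕ) (h : n ≤ m) :
    PowExt I j N n →ₗ[R] PowExt I j N m :=
  Ext.precompOfLinear (Ext.mk₀ (powQuot I h)) R N (zero_add j)

instance (j : ℕ) (N : ModuleCat.{0} R) :
    DirectedSystem (PowExt I j N) (fun n m h => powExtMap I j N n m h) where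
  map_self n x := by simp [powQuot_refl]
  map_map n m k h h' x := by simp [powQuot_comp]

/-- Local cohomology as the direct limit of the modules `Ext^j(R / I ^ n, N)`. -/
abbrev LocCoh (j : ℕ) (N : ModuleCat.{0} R) : Type :=
  Module.DirectLimit (PowExt I j N) (powExtMap I j N)

/-- The class in local cohomology of an element of `Ext^j(R / I ^ n, N)`. -/
abbrev LocCoh.of (j : ℕ) (N : ModuleCat.{0} R) (n : ℕ) : PowExt I j N n →ₗ[R] LocCoh I j N :=
  Module.DirectLimit.of R ℕ (PowExt I j N) (powExtMap I j N) n

lemma powExtMap_comp (I : Ideal R) {N N' : ModuleCat.{0} R} {a : ℕ} (α : Ext N N' a) {j k : ℕ}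
    (h : j + a = k) {n m : ℕ} (hnm : n ≤ m) (x : PowExt I j N n) :
    powExtMap I k N' n m hnm (x.comp α h) = Ext.comp (powExtMap I j N n m hnm x) α h := by
  simp only [Ext.bilinearCompOfLinear_apply_apply]
  exact (Ext.comp_assoc (Ext.mk₀ (powQuot I hnm)) x α (zero_add j) h (by omega)).symm

/-- The map on local cohomology induced by an extension class. -/
def LocCoh.post {N N' : ModuleCat.{0} R} {a : ℕ} (α : Ext N N' a) {j k : ℕ} (h : j + a = k) :
    LocCoh I j N →ₗ[R] LocCoh I k N' :=
  Module.DirectLimit.map (fun _ => Ext.postcompOfLinear α R _ h) fun _ _ hnm =>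
    LinearMap.ext fun x => (powExtMap_comp I α h hnm x).symm

variable {I}

lemma LocCoh.post_of {N N' : ModuleCat.{0} R} {a : ℕ} (α : Ext N N' a) {j k : ℕ} (h : j + a = k)
    {n : ℕ} (x : PowExt I j N n) :
    LocCoh.post I α h (LocCoh.of I j N n x) = LocCoh.of I k N' n (x.comp α h) :=
  Module.DirectLimit.map_apply_of ..

lemma LocCoh.exists_of {j : ℕ} {N : ModuleCat.{0} R} (z : LocCoh I j N) :
    ∃ n x, LocCoh.of I j N n x = z :=
  Module.DirectLimit.exists_of z

lemma LocCoh.of_eq_zero_iff {j : ℕ} {N : ModuleCat.{0} R} {n : ℕ} (x : PowExt I j N n) :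
    LocCoh.of I j N n x = 0 ↔ ∃ m, ∃ h : n ≤ m, powExtMap I j N n m h x = 0 := by
  constructor
  · exact fun h => Module.DirectLimit.of.zero_exact h
  · rintro ⟨m, h, hx⟩
    have := Module.DirectLimit.of_f (R := R) (ι := ℕ) (f := powExtMap I j N) (hij := h) (x := x)
    rw [← this, hx, map_zero]

section Exact

variable {S : ShortComplex (ModuleCat.{0} R)} (hS : S.ShortExact)
include hS

lemma LocCoh.exact₂ {j : ℕ} (z : LocCoh I j S.X₂)
    (hz : LocCoh.post I (Ext.mk₀ S.g) (add_zero j) z = 0) :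
    ∃ w, LocCoh.post I (Ext.mk₀ S.f) (add_zero j) w = z := by
  obtain ⟨n, x, rfl⟩ := LocCoh.exists_of z
  rw [LocCoh.post_of, LocCoh.of_eq_zero_iff] at hz
  obtain ⟨m, h, hx⟩ := hz
  rw [powExtMap_comp] at hx
  obtain ⟨w, hw⟩ := Ext.covariant_sequence_exact₂ _ hS _ hx
  exact ⟨LocCoh.of I j _ m w, by
    rw [LocCoh.post_of, hw]; exact Module.DirectLimit.of_f⟩

lemma LocCoh.exact₃ {j : ℕ} (z : LocCoh I j S.X₃)
    (hz : LocCoh.post I hS.extClass (rfl : j + 1 = j + 1) z = 0) :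
    ∃ w, LocCoh.post I (Ext.mk₀ S.g) (add_zero j) w = z := by
  obtain ⟨n, x, rfl⟩ := LocCoh.exists_of z
  rw [LocCoh.post_of, LocCoh.of_eq_zero_iff] at hz
  obtain ⟨m, h, hx⟩ := hz
  rw [powExtMap_comp] at hx
  obtain ⟨w, hw⟩ := Ext.covariant_sequence_exact₃ _ hS _ rfl hx
  exact ⟨LocCoh.of I j _ m w, by
    rw [LocCoh.post_of, hw]; exact Module.DirectLimit.of_f⟩

lemma LocCoh.exact₁ {j : ℕ} (z : LocCoh I (j + 1) S.X₁)
    (hz : LocCoh.post I (Ext.mk₀ S.f) (add_zero (j + 1)) z = 0) :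
    ∃ w, LocCoh.post I hS.extClass (rfl : j + 1 = j + 1) w = z := by
  obtain ⟨n, x, rfl⟩ := LocCoh.exists_of z
  rw [LocCoh.post_of, LocCoh.of_eq_zero_iff] at hz
  obtain ⟨m, h, hx⟩ := hz
  rw [powExtMap_comp] at hx
  obtain ⟨w, hw⟩ := Ext.covariant_sequence_exact₁ _ hS _ hx rfl
  exact ⟨LocCoh.of I j _ m w, by
    rw [LocCoh.post_of, hw]; exact Module.DirectLimit.of_f⟩

lemma LocCoh.post_injective (j : ℕ) [Subsingleton (LocCoh I j S.X₂)] :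
    Function.Injective (LocCoh.post I hS.extClass (rfl : j + 1 = j + 1)) := by
  refine (injective_iff_map_eq_zero _).2 fun z hz => ?_
  obtain ⟨w, rfl⟩ := LocCoh.exact₃ hS z hz
  rw [Subsingleton.elim w 0, map_zero]

lemma LocCoh.post_f_surjective (j : ℕ) [Subsingleton (LocCoh I j S.X₃)] :
    Function.Surjective (LocCoh.post I (Ext.mk₀ S.f) (add_zero j)) := fun z =>
  LocCoh.exact₂ hS z (Subsingleton.elim _ _)

lemma LocCoh.post_g_surjective (j : ℕ) [Subsingleton (LocCoh I (j + 1) S.X₁)] :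
    Function.Surjective (LocCoh.post I (Ext.mk₀ S.g) (add_zero j)) := fun z =>
  LocCoh.exact₃ hS z (Subsingleton.elim _ _)

end Exact

lemma LocCoh.exists_pow_smul {j : ℕ} {N : ModuleCat.{0} R} (z : LocCoh I j N) :
    ∃ k, ∀ r ∈ I ^ k, r • z = 0 := by
  obtain ⟨n, x, rfl⟩ := LocCoh.exists_of z
  refine ⟨n, fun r hr => ?_⟩
  have h : r • x = 0 := by
    have h1 : r • 𝟙 (ModuleCat.of R (R ⧸ I ^ n)) = 0 := by
      refine ModuleCat.hom_ext (LinearMap.ext fun y => ?_)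
      obtain ⟨y, rfl⟩ := Ideal.Quotient.mk_surjective y
      exact Ideal.Quotient.eq_zero_iff_mem.2 ((I ^ n).mul_mem_right _ hr)
    have h2 := Ext.smul_comp (Ext.mk₀ (𝟙 (ModuleCat.of R (R ⧸ I ^ n)))) x (zero_add j) r
    rw [← Ext.mk₀_smul, h1, Ext.mk₀_zero, Ext.zero_comp, Ext.mk₀_id_comp] at h2
    exact h2.symm
  rw [← map_smul, h, map_zero]

lemma LocCoh.post_smul_id {j : ℕ} {N : ModuleCat.{0} R} (r : R) (z : LocCoh I j N) :
    LocCoh.post I (Ext.mk₀ (r • 𝟙 N)) (add_zero j) z = r • z := by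
  obtain ⟨n, x, rfl⟩ := LocCoh.exists_of z
  rw [LocCoh.post_of, ← map_smul, Ext.smul_eq_comp_mk₀]

lemma LocCoh.subsingleton_of_smul {j : ℕ} {N : ModuleCat.{0} R} {r : R} (hr : r ∈ I)
    (h : ∀ z : LocCoh I j N, r • z = 0 → z = 0) : Subsingleton (LocCoh I j N) := by
  refine subsingleton_of_forall_eq 0 fun z => ?_
  obtain ⟨k, hk⟩ := LocCoh.exists_pow_smul z
  have := hk _ (Ideal.pow_mem_pow hr k)
  clear hk
  induction k with
  | zero => simpa using this
  | succ k ih => exact ih (h _ (by rwa [smul_smul, ← pow_succ']))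

lemma LocCoh.subsingleton_of_isZero (j : ℕ) (N : ModuleCat.{0} R) [Subsingleton N] :
    Subsingleton (LocCoh I j N) := by
  refine subsingleton_of_forall_eq 0 fun z => ?_
  obtain ⟨n, x, rfl⟩ := LocCoh.exists_of z
  have h : 𝟙 N = 0 := by ext y; exact Subsingleton.elim _ _
  rw [← Ext.comp_mk₀_id x, h, Ext.mk₀_zero, Ext.comp_zero, map_zero]

/-- The short exact sequence of module objects attached to an exact pair of linear maps. -/
abbrev sesOf {N₁ N₂ N₃ : Type} [AddCommGroup N₁] [Module R N₁] [AddCommGroup N₂]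
    [Module R N₂] [AddCommGroup N₃] [Module R N₃] (f : N₁ →ₗ[R] N₂) (g : N₂ →ₗ[R] N₃)
    (hfg : Function.Exact f g) : ShortComplex (ModuleCat.{0} R) :=
  ShortComplex.mk (ModuleCat.ofHom f) (ModuleCat.ofHom g) (by
    ext x; exact hfg.apply_apply_eq_zero x)

lemma sesOf_shortExact {N₁ N₂ N₃ : Type} [AddCommGroup N₁] [Module R N₁] [AddCommGroup N₂]
    [Module R N₂] [AddCommGroup N₃] [Module R N₃] {f : N₁ →ₗ[R] N₂} {g : N₂ →ₗ[R] N₃}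
    (hfg : Function.Exact f g) (hf : Function.Injective f) (hg : Function.Surjective g) :
    (sesOf f g hfg).ShortExact where
  exact := (ShortComplex.ShortExact.moduleCat_exact_iff_function_exact _).2 hfg
  mono_f := (ModuleCat.mono_iff_injective _).2 hf
  epi_g := (ModuleCat.epi_iff_surjective _).2 hg

/-- The elements of a module killed by a power of `I`. -/
def powTorsion (I : Ideal R) (E : Type) [AddCommGroup E] [Module R E] : Submodule R E where
  carrier := {x | ∃ k, ∀ r ∈ I ^ k, r • x = 0}
  zero_mem' := ⟨0, fun r _ => smul_zero r⟩
  add_mem' := by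
    rintro x y ⟨k, hk⟩ ⟨l, hl⟩
    refine ⟨k + l, fun r hr => ?_⟩
    rw [smul_add, hk r (Ideal.pow_le_pow_right (Nat.le_add_right k l) hr),
      hl r (Ideal.pow_le_pow_right (Nat.le_add_left l k) hr), add_zero]
  smul_mem' := by
    rintro c x ⟨k, hk⟩
    exact ⟨k, fun r hr => by rw [smul_comm, hk r hr, smul_zero]⟩

lemma exists_pow_smul_of_fg {E : Type} [AddCommGroup E] [Module R E] {P : Submodule R E}
    (hP : P.FG) (h : P ≤ powTorsion I E) : ∃ k, ∀ r ∈ I ^ k, ∀ x ∈ P, r • x = 0 := by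
  induction P, hP using Submodule.fg_induction with
  | singleton x =>
    obtain ⟨k, hk⟩ := h (Submodule.mem_span_singleton_self x)
    refine ⟨k, fun r hr y hy => ?_⟩
    obtain ⟨c, rfl⟩ := Submodule.mem_span_singleton.1 hy
    rw [smul_comm, hk r hr, smul_zero]
  | sup P Q _ _ hP hQ =>
    obtain ⟨k, hk⟩ := hP (le_sup_left.trans h)
    obtain ⟨l, hl⟩ := hQ (le_sup_right.trans h)
    refine ⟨k + l, fun r hr x hx => ?_⟩
    obtain ⟨a, ha, b, hb, rfl⟩ := Submodule.mem_sup.1 hx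
    rw [smul_add, hk r (Ideal.pow_le_pow_right (Nat.le_add_right k l) hr) a ha,
      hl r (Ideal.pow_le_pow_right (Nat.le_add_left l k) hr) b hb, add_zero]

/-- The torsion part of an injective module over a Noetherian ring is injective. -/
lemma injective_powTorsion [IsNoetherianRing R] (E : Type) [AddCommGroup E] [Module R E]
    [Module.Injective R E] : Module.Injective R (powTorsion I E) := by
  refine Module.Baer.injective fun J f => ?_
  obtain ⟨k, hk⟩ := exists_pow_smul_of_fg (I := I)
    (P := LinearMap.range ((powTorsion I E).subtype ∘ₗ f)) (by
      rw [LinearMap.range_eq_map]; exact (Submodule.fg_top J |>.2 (IsNoetherian.noetherian J)).map _)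
    (by rintro _ ⟨x, rfl⟩; exact (f x).2)
  obtain ⟨c, hc⟩ := Ideal.exists_pow_inf_eq_pow_smul I (N := (J : Submodule R R))
  let φ : J →ₗ[R] R ⧸ I ^ (k + c) := (Submodule.mkQ (I ^ (k + c))).comp J.subtype
  have hφ : LinearMap.ker φ ≤ LinearMap.ker ((powTorsion I E).subtype ∘ₗ f) := by
    intro x hx
    have h1 : (x : R) ∈ I ^ (k + c) := Ideal.Quotient.eq_zero_iff_mem.1 hx
    have h2 : (x : R) ∈ I ^ k • ((I ^ c • ⊤ : Submodule R R) ⊓ J) := by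
      have := hc (k + c) (Nat.le_add_left c k)
      rw [Nat.add_sub_cancel] at this
      rw [← this]
      exact ⟨by simpa using h1, x.2⟩
    have h3 : I ^ k • ((I ^ c • ⊤ : Submodule R R) ⊓ J) ≤
        (LinearMap.ker ((powTorsion I E).subtype ∘ₗ f)).map J.subtype := by
      refine Submodule.smul_le.2 fun r hr y hy => ⟨r • ⟨y, hy.2⟩, ?_, rfl⟩
      rw [SetLike.mem_coe, LinearMap.mem_ker, map_smul]
      exact hk r hr _ ⟨_, rfl⟩
    obtain ⟨z, hz, hzx⟩ := h3 h2
    rwa [← Subtype.ext hzx]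
  obtain ⟨h, hh⟩ := Module.Injective.out ((LinearMap.ker φ).liftQ φ le_rfl)
    (LinearMap.ker_eq_bot.1 (Submodule.ker_liftQ_eq_bot _ _ _ le_rfl))
    ((LinearMap.ker φ).liftQ _ hφ)
  have hmem : h (Submodule.Quotient.mk 1) ∈ powTorsion I E := by
    refine ⟨k + c, fun r hr => ?_⟩
    rw [← map_smul, ← Submodule.Quotient.mk_smul, (Submodule.Quotient.mk_eq_zero _).2, map_zero]
    simpa using hr
  refine ⟨LinearMap.toSpanSingleton R _ ⟨_, hmem⟩, fun x hx => Subtype.ext ?_⟩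
  have := hh (Submodule.Quotient.mk ⟨x, hx⟩)
  simp only [Submodule.liftQ_apply] at this
  rw [LinearMap.toSpanSingleton_apply]
  refine Eq.trans ?_ this
  change x • h _ = _
  rw [← map_smul, ← Submodule.Quotient.mk_smul]
  simp [φ]

lemma LocCoh.subsingleton_of_injective (j : ℕ) (E : ModuleCat.{0} R) [Injective E] :
    Subsingleton (LocCoh I (j + 1) E) := by
  refine subsingleton_of_forall_eq 0 fun z => ?_
  obtain ⟨n, x, rfl⟩ := LocCoh.exists_of z
  rw [Ext.eq_zero_of_injective x, map_zero]

/-- Sections with support lift along surjections from torsion modules. -/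
lemma LocCoh.post_surjective_of_torsion {G Q : Type} [AddCommGroup G] [Module R G]
    [AddCommGroup Q] [Module R Q] (g : G →ₗ[R] Q) (hg : Function.Surjective g)
    (hG : powTorsion I G = ⊤) :
    Function.Surjective (LocCoh.post I (Ext.mk₀ (ModuleCat.ofHom g)) (add_zero 0)) := by
  intro z
  obtain ⟨n, x, rfl⟩ := LocCoh.exists_of z
  obtain ⟨φ, rfl⟩ := Ext.mk₀_bijective _ _ |>.2 x
  obtain ⟨a, ha⟩ := hg (φ (Submodule.Quotient.mk 1))
  obtain ⟨k, hk⟩ : a ∈ powTorsion I G := hG ▸ Submodule.mem_top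
  let ψ : R ⧸ I ^ (n + k) →ₗ[R] G := Submodule.liftQ _ (LinearMap.toSpanSingleton R G a)
    fun r hr => hk r (Ideal.pow_le_pow_right (Nat.le_add_left k n) hr)
  refine ⟨LocCoh.of I 0 _ (n + k) (Ext.mk₀ (ModuleCat.ofHom ψ)), ?_⟩
  have h1 : ModuleCat.ofHom ψ ≫ ModuleCat.ofHom g = powQuot I (Nat.le_add_right n k) ≫ φ := by
    refine ModuleCat.hom_ext (LinearMap.ext fun y => ?_)
    obtain ⟨y, rfl⟩ := Ideal.Quotient.mk_surjective y
    change g (y • a) = φ (Submodule.Quotient.mk y)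
    rw [map_smul, ha, ← map_smul, ← Submodule.Quotient.mk_smul, smul_eq_mul, mul_one]
  rw [LocCoh.post_of, Ext.mk₀_comp_mk₀, h1, ← Ext.mk₀_comp_mk₀]
  exact Module.DirectLimit.of_f (f := powExtMap I 0 (ModuleCat.of R Q))

/-- A torsion module embeds in an injective torsion module. -/
lemma exists_torsion_embedding [IsNoetherianRing R] (N : Type) [AddCommGroup N] [Module R N]
    (hN : powTorsion I N = ⊤) :
    ∃ (G : Type) (_ : AddCommGroup G) (_ : Module R G) (f : N →ₗ[R] G) (Q : Type)
      (_ : AddCommGroup Q) (_ : Module R Q) (g : G →ₗ[R] Q), Function.Injective f ∧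
      Function.Surjective g ∧ Function.Exact f g ∧ Injective (ModuleCat.of R G) ∧
      powTorsion I G = ⊤ ∧ powTorsion I Q = ⊤ := by
  let E : ModuleCat.{0} R := Injective.under (ModuleCat.of R N)
  have : Injective (ModuleCat.of R E) := inferInstanceAs (Injective E)
  have : Module.Injective R E := Module.injective_module_of_injective_object R E
  let ι : N →ₗ[R] E := (Injective.ι (ModuleCat.of R N)).hom
  have hι : Function.Injective ι := (ModuleCat.mono_iff_injective _).1 (Injective.ι_mono _)
  let f : N →ₗ[R] powTorsion I E := ι.codRestrict _ (by
    intro x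
    obtain ⟨k, hk⟩ : x ∈ powTorsion I N := hN ▸ Submodule.mem_top
    exact ⟨k, fun r hr => by rw [← map_smul, hk r hr, map_zero]⟩)
  have hG : powTorsion I (powTorsion I E) = ⊤ := by
    refine eq_top_iff.2 fun x _ => ?_
    obtain ⟨k, hk⟩ := x.2
    exact ⟨k, fun r hr => Subtype.ext (hk r hr)⟩
  have := injective_powTorsion (I := I) E
  refine ⟨powTorsion I E, inferInstance, inferInstance, f, _ ⧸ LinearMap.range f, inferInstance,
    inferInstance, (LinearMap.range f).mkQ, fun x y h => hι (congrArg Subtype.val h),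
    Submodule.mkQ_surjective _, ?_, Module.injective_object_of_injective_module R _, hG, ?_⟩
  · rw [LinearMap.exact_iff, Submodule.ker_mkQ]
  · refine eq_top_iff.2 fun x _ => ?_
    obtain ⟨x, rfl⟩ := Submodule.mkQ_surjective _ x
    obtain ⟨k, hk⟩ : x ∈ powTorsion I (powTorsion I E) := hG ▸ Submodule.mem_top
    exact ⟨k, fun r hr => by rw [← map_smul, hk r hr, map_zero]⟩

lemma LocCoh.subsingleton_of_torsion [IsNoetherianRing R] (j : ℕ) :
    ∀ (N : Type) [AddCommGroup N] [Module R N], powTorsion I N = ⊤ →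
      Subsingleton (LocCoh I (j + 1) (ModuleCat.of R N)) := by
  induction j with
  | zero =>
    intro N _ _ hN
    obtain ⟨G, _, _, f, Q, _, _, g, hf, hg, hfg, hG, hGt, -⟩ := exists_torsion_embedding N hN
    have hS := sesOf_shortExact hfg hf hg
    refine subsingleton_of_forall_eq 0 fun z => ?_
    obtain ⟨w, rfl⟩ := LocCoh.exact₁ hS z
      (Subsingleton.elim (h := LocCoh.subsingleton_of_injective 0 (ModuleCat.of R G)) _ _)
    obtain ⟨u, rfl⟩ := LocCoh.post_surjective_of_torsion g hg hGt w
    obtain ⟨n, x, rfl⟩ := LocCoh.exists_of u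
    rw [LocCoh.post_of, LocCoh.post_of, Ext.comp_assoc_of_second_deg_zero]
    erw [hS.comp_extClass]
    rw [Ext.comp_zero, map_zero]
  | succ j ih =>
    intro N _ _ hN
    obtain ⟨G, _, _, f, Q, _, _, g, hf, hg, hfg, hG, -, hQt⟩ := exists_torsion_embedding N hN
    have hS := sesOf_shortExact hfg hf hg
    refine subsingleton_of_forall_eq 0 fun z => ?_
    obtain ⟨w, rfl⟩ := LocCoh.exact₁ hS z
      (Subsingleton.elim (h := LocCoh.subsingleton_of_injective (j + 1) (ModuleCat.of R G)) _ _)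
    rw [Subsingleton.elim (h := ih Q hQt) w 0, map_zero]

open scoped Pointwise in
/-- The vanishing of local cohomology. -/
lemma isVanishing_locCoh [IsNoetherianRing R] :
    IsVanishing I (fun j N _ _ => Subsingleton (LocCoh I j (ModuleCat.of R N))) where
  subsingleton j N _ _ h := by
    have : Subsingleton (ModuleCat.of R N) := h
    exact LocCoh.subsingleton_of_isZero _ _
  regular_zero N _ _ r hr hreg := by
    refine LocCoh.subsingleton_of_smul hr fun z hz => ?_
    obtain ⟨n, x, rfl⟩ := LocCoh.exists_of z
    rw [← map_smul, LocCoh.of_eq_zero_iff] at hz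
    obtain ⟨m, h, hx⟩ := hz
    refine (LocCoh.of_eq_zero_iff x).2 ⟨m, h, ?_⟩
    have : Mono (r • 𝟙 (ModuleCat.of R N)) := (ModuleCat.mono_iff_injective _).2 hreg
    refine Ext.postcomp_mk₀_injective_of_mono _ (r • 𝟙 (ModuleCat.of R N)) ?_
    change Ext.comp _ _ (add_zero 0) = Ext.comp 0 _ (add_zero 0)
    rw [← Ext.smul_eq_comp_mk₀, ← map_smul, hx, Ext.zero_comp]
  regular_succ j N _ _ r hr hreg h := by
    refine LocCoh.subsingleton_of_smul hr fun z hz => ?_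
    have hS := sesOf_shortExact (f := LinearMap.lsmul R N r) (g := (r • (⊤ : Submodule R N)).mkQ)
      (by
        rw [LinearMap.exact_iff, Submodule.ker_mkQ]
        ext x
        simp [Submodule.mem_smul_pointwise_iff_exists]) hreg (Submodule.mkQ_surjective _)
    rw [← LocCoh.post_smul_id] at hz
    obtain ⟨w, rfl⟩ := LocCoh.exact₁ hS z hz
    have : Subsingleton (LocCoh I j (ModuleCat.of R (QuotSMulTop r N))) := h
    have hw : w = 0 := Subsingleton.elim (α := LocCoh I j (ModuleCat.of R (QuotSMulTop r N))) _ _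
    rw [hw, map_zero]
  exact j N₁ N₂ N₃ _ _ _ _ _ _ f g hf hg hfg h₁ h₃ := by
    refine subsingleton_of_forall_eq 0 fun z => ?_
    have hS := sesOf_shortExact hfg hf hg
    obtain ⟨w, rfl⟩ := LocCoh.exact₂ hS z (Subsingleton.elim (h := h₃) _ _)
    rw [Subsingleton.elim (h := h₁) w 0, map_zero]
  torsion j N _ _ h := LocCoh.subsingleton_of_torsion j N (by
    refine eq_top_iff.2 fun x _ => ⟨1, fun r hr => h r ?_ x⟩
    rwa [pow_one] at hr)

end LocalCohomology

section Comparison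

open CategoryTheory.Abelian CategoryTheory.Limits Opposite

section Resolution

variable {X : ModuleCat.{0} R} (P : ProjectiveResolution X) (Y : ModuleCat.{0} R) (j : ℕ)

lemma extMk_eq_zero_iff_of_zero (f : P.complex.X 0 ⟶ Y) (hf : P.complex.d 1 0 ≫ f = 0) :
    P.extMk f 1 rfl hf = 0 ↔ f = 0 := by
  constructor
  · intro h
    simp only [← P.extEquivCohomologyClass.apply_eq_iff_eq,
      ProjectiveResolution.extEquivCohomologyClass_extMk,
      ProjectiveResolution.extEquivCohomologyClass_zero,
      CochainComplex.HomComplex.CohomologyClass.mk_eq_zero_iff] at h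
    rw [CochainComplex.HomComplex.Cocycle.toSingleMk_mem_coboundaries_iff _ _ _ _ _ 1 (by simp)]
      at h
    obtain ⟨g, hg⟩ := h
    have hz : IsZero (P.cochainComplex.X 1) := CochainComplex.isZero_of_isStrictlyLE _ 0 _
    rw [hz.eq_of_src g 0, comp_zero] at hg
    exact (Preadditive.IsIso.comp_left_eq_zero _ _).1 hg.symm
  · rintro rfl
    simp

/-- The cochain complex `Hom(P, Y)` attached to a projective resolution `P`. -/
abbrev homComplex : CochainComplex (ModuleCat.{0} R) ℕ := P.complex.linearYonedaObj R Y

/-- The homomorphism underlying a cocycle. -/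
def cycleHom : (homComplex P Y).cycles j →ₗ[R] (P.complex.X j ⟶ Y) :=
  ((homComplex P Y).iCycles j).hom

lemma d_comp_cycleHom (z : (homComplex P Y).cycles j) :
    P.complex.d (j + 1) j ≫ cycleHom P Y j z = 0 :=
  congrArg (fun f => f.hom z) ((homComplex P Y).iCycles_d j (j + 1))

lemma cycleHom_injective : Function.Injective (cycleHom P Y j) :=
  (ModuleCat.mono_iff_injective ((homComplex P Y).iCycles j)).1 inferInstance

lemma exists_cycleHom_eq (f : P.complex.X j ⟶ Y) (hf : P.complex.d (j + 1) j ≫ f = 0) :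
    ∃ z, cycleHom P Y j z = f := by
  have h := ShortComplex.exact_of_f_is_kernel
    (ShortComplex.mk _ _ ((homComplex P Y).iCycles_d j (j + 1)))
    ((homComplex P Y).cyclesIsKernel j (j + 1) (by simp))
  exact (ShortComplex.moduleCat_exact_iff _).1 h f hf

lemma homologyπ_eq_zero_iff (z : (homComplex P Y).cycles j) :
    (homComplex P Y).homologyπ j z = 0 ↔ ∃ w : P.complex.X ((ComplexShape.up ℕ).prev j) ⟶ Y,
      P.complex.d j ((ComplexShape.up ℕ).prev j) ≫ w = cycleHom P Y j z := by
  have h := ShortComplex.exact_of_g_is_cokernel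
    (ShortComplex.mk _ _ ((homComplex P Y).toCycles_comp_homologyπ
      ((ComplexShape.up ℕ).prev j) j))
    ((homComplex P Y).homologyIsCokernel _ j rfl)
  have hd := (homComplex P Y).toCycles_i ((ComplexShape.up ℕ).prev j) j
  constructor
  · intro hz
    obtain ⟨w, hw⟩ := (ShortComplex.moduleCat_exact_iff _).1 h z hz
    refine ⟨w, ?_⟩
    rw [← hw]
    exact (congrArg (fun f => f.hom w) hd).symm
  · rintro ⟨w, hw⟩
    have : z = (homComplex P Y).toCycles ((ComplexShape.up ℕ).prev j) j w :=
      cycleHom_injective P Y j (hw.symm.trans (congrArg (fun f => f.hom w) hd).symm)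
    rw [this]
    exact congrArg (fun f => f.hom w) ((homComplex P Y).toCycles_comp_homologyπ _ j)

/-- The extension class of a cocycle. -/
def cycleExt : (homComplex P Y).cycles j →ₗ[R] Ext X Y j where
  toFun z := P.extMk (cycleHom P Y j z) (j + 1) rfl (d_comp_cycleHom P Y j z)
  map_add' z w := by
    rw [ProjectiveResolution.add_extMk]
    congr 1
    exact map_add _ z w
  map_smul' r z := by
    rw [RingHom.id_apply, Ext.smul_eq_comp_mk₀, ProjectiveResolution.extMk_comp_mk₀]
    congr 1
    rw [map_smul]
    simp

lemma cycleExt_surjective : Function.Surjective (cycleExt P Y j) := by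
  intro α
  obtain ⟨f, hf, rfl⟩ := P.extMk_surjective α (j + 1) rfl
  obtain ⟨z, rfl⟩ := exists_cycleHom_eq P Y j f hf
  exact ⟨z, rfl⟩

lemma cycleExt_eq_zero_iff (z : (homComplex P Y).cycles j) :
    cycleExt P Y j z = 0 ↔ (homComplex P Y).homologyπ j z = 0 := by
  rw [homologyπ_eq_zero_iff]
  cases j with
  | zero =>
    refine (extMk_eq_zero_iff_of_zero P Y _ (d_comp_cycleHom P Y 0 z)).trans ⟨fun h => ⟨0, by rw [h, comp_zero]⟩, ?_⟩
    rintro ⟨w, hw⟩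
    rw [← hw, HomologicalComplex.shape, zero_comp]
    simp
  | succ j =>
    have h : (ComplexShape.up ℕ).prev (j + 1) = j := by simp
    rw [h]
    exact P.extMk_eq_zero_iff (cycleHom P Y (j + 1) z) (j + 2) rfl
      (d_comp_cycleHom P Y (j + 1) z) j rfl

/-- The class in the derived functor of a cocycle. -/
def cycleDerived : (homComplex P Y).cycles j →ₗ[R]
    ((_root_.Ext R (ModuleCat.{0} R) j).obj (op X)).obj Y :=
  ((homComplex P Y).homologyπ j ≫ (P.isoExt j Y).inv).hom

lemma cycleDerived_surjective : Function.Surjective (cycleDerived P Y j) :=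
  (ModuleCat.epi_iff_surjective _).1 inferInstance

lemma cycleDerived_eq_zero_iff (z : (homComplex P Y).cycles j) :
    cycleDerived P Y j z = 0 ↔ (homComplex P Y).homologyπ j z = 0 := by
  have h : Function.Injective (P.isoExt (R := R) j Y).inv :=
    (ModuleCat.mono_iff_injective _).1 inferInstance
  refine ⟨fun hz => h (hz.trans (map_zero _).symm), fun hz => ?_⟩
  change (P.isoExt (R := R) j Y).inv ((homComplex P Y).homologyπ j z) = 0
  rw [hz, map_zero]

lemma exists_linearEquiv_of_ker_eq {Z A B : Type} [AddCommGroup Z] [Module R Z] [AddCommGroup A]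
    [Module R A] [AddCommGroup B] [Module R B] (a : Z →ₗ[R] A) (b : Z →ₗ[R] B)
    (ha : Function.Surjective a) (hb : Function.Surjective b)
    (h : LinearMap.ker a = LinearMap.ker b) : ∃ e : A ≃ₗ[R] B, ∀ z, e (a z) = b z :=
  ⟨(a.quotKerEquivOfSurjective ha).symm ≪≫ₗ Submodule.quotEquivOfEq _ _ h ≪≫ₗ
    b.quotKerEquivOfSurjective hb, fun z => by
      have : (a.quotKerEquivOfSurjective ha).symm (a z) = Submodule.Quotient.mk z := by
        rw [LinearEquiv.symm_apply_eq]; rfl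
      simp [this]⟩

/-- The comparison of the derived functor of `Hom` with the group of extensions. -/
lemma exists_extEquiv : ∃ e : ((_root_.Ext R (ModuleCat.{0} R) j).obj (op X)).obj Y ≃ₗ[R]
    Ext X Y j, ∀ z, e (cycleDerived P Y j z) = cycleExt P Y j z :=
  exists_linearEquiv_of_ker_eq _ _ (cycleDerived_surjective P Y j) (cycleExt_surjective P Y j) (by
    ext z
    rw [LinearMap.mem_ker, LinearMap.mem_ker, cycleDerived_eq_zero_iff, cycleExt_eq_zero_iff])

section Naturality

variable {P} {X' : ModuleCat.{0} R} {P' : ProjectiveResolution X'} {g : X ⟶ X'}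
  (φ : ProjectiveResolution.Hom P P' g)

/-- The map of cochain complexes induced by a morphism of resolutions. -/
def homComplexMap : homComplex P' Y ⟶ homComplex P Y :=
  (HomologicalComplex.unopFunctor _ _).map
    (((((linearYoneda R (ModuleCat.{0} R)).obj Y).rightOp.mapHomologicalComplex _).map φ.hom).op)

lemma cycleHom_map (z : (homComplex P' Y).cycles j) :
    cycleHom P Y j (HomologicalComplex.cyclesMap (homComplexMap Y φ) j z) =
      φ.hom.f j ≫ cycleHom P' Y j z :=
  congrArg (fun f => f.hom z) (HomologicalComplex.cyclesMap_i (homComplexMap Y φ) j)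

lemma cycleExt_map (z : (homComplex P' Y).cycles j) :
    cycleExt P Y j (HomologicalComplex.cyclesMap (homComplexMap Y φ) j z) =
      (Ext.mk₀ g).comp (cycleExt P' Y j z) (zero_add j) := by
  refine Eq.trans ?_ (ProjectiveResolution.mk₀_comp_extMk (cycleHom P' Y j z)
    (j + 1) rfl (d_comp_cycleHom P' Y j z) φ).symm
  change P.extMk (cycleHom P Y j (HomologicalComplex.cyclesMap (homComplexMap Y φ) j z))
    (j + 1) rfl (d_comp_cycleHom P Y j _) = _
  congr 1
  exact cycleHom_map Y j φ z

lemma cycleDerived_map (z : (homComplex P' Y).cycles j) :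
    cycleDerived P Y j (HomologicalComplex.cyclesMap (homComplexMap Y φ) j z) =
      ((_root_.Ext R (ModuleCat.{0} R) j).map g.op).app Y (cycleDerived P' Y j z) := by
  have h1 := HomologicalComplex.homologyπ_naturality (homComplexMap Y φ) j
  have h2 : HomologicalComplex.homologyMap (homComplexMap Y φ) j ≫ (P.isoExt (R := R) j Y).inv =
      (P'.isoExt (R := R) j Y).inv ≫ ((_root_.Ext R (ModuleCat.{0} R) j).map g.op).app Y := by
    have h3 := P.isoLeftDerivedObj_hom_naturality g P' φ.hom φ.hom_f_zero_comp_π_f_zero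
      ((linearYoneda R (ModuleCat.{0} R)).obj Y).rightOp j
    have h4 := HomologicalComplex.homologyOp_hom_naturality (homComplexMap Y φ) j
    have h5 : HomologicalComplex.homologyMap (homComplexMap Y φ) j ≫
        ((homComplex P Y).homologyOp j).hom.unop =
        ((homComplex P' Y).homologyOp j).hom.unop ≫
          (HomologicalComplex.homologyMap
            ((HomologicalComplex.opFunctor _ _).map (homComplexMap Y φ).op) j).unop :=
      congrArg Quiver.Hom.unop h4.symm
    have h6 := congrArg Quiver.Hom.unop h3
    have h7 := congrArg (· ≫ (P.isoLeftDerivedObj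
      ((linearYoneda R (ModuleCat.{0} R)).obj Y).rightOp j).hom.unop) h5
    have h8 := congrArg (((homComplex P' Y).homologyOp j).hom.unop ≫ ·) h6
    exact h7.trans h8.symm
  have h4 := congrArg (fun f => f.hom z) (congrArg (· ≫ (P.isoExt (R := R) j Y).inv) h1)
  have h5 := congrArg (fun f => f.hom ((homComplex P' Y).homologyπ j z)) h2
  exact h4.symm.trans h5

end Naturality

end Resolution

/-- The morphism of standard projective resolutions over a morphism of modules. -/
def resolutionHom {X X' : ModuleCat.{0} R} (g : X ⟶ X') :
    ProjectiveResolution.Hom (projectiveResolution X) (projectiveResolution X') g where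
  hom := ProjectiveResolution.lift g _ _
  hom_f_zero_comp_π_f_zero :=
    HomologicalComplex.congr_hom (ProjectiveResolution.lift_commutes g _ _) 0

/-- The comparison of the derived functor of `Hom` with the group of extensions. -/
def extEquiv (X Y : ModuleCat.{0} R) (j : ℕ) :
    ((_root_.Ext R (ModuleCat.{0} R) j).obj (op X)).obj Y ≃ₗ[R] Ext X Y j :=
  (exists_extEquiv (projectiveResolution X) Y j).choose

lemma extEquiv_map {X X' : ModuleCat.{0} R} (g : X ⟶ X') (Y : ModuleCat.{0} R) (j : ℕ)
    (x : ((_root_.Ext R (ModuleCat.{0} R) j).obj (op X')).obj Y) :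
    extEquiv X Y j (((_root_.Ext R (ModuleCat.{0} R) j).map g.op).app Y x) =
      (Ext.mk₀ g).comp (extEquiv X' Y j x) (zero_add j) := by
  obtain ⟨z, rfl⟩ := cycleDerived_surjective (projectiveResolution X') Y j x
  rw [← cycleDerived_map Y j (resolutionHom g)]
  erw [(exists_extEquiv (projectiveResolution X) Y j).choose_spec,
    (exists_extEquiv (projectiveResolution X') Y j).choose_spec]
  exact cycleExt_map Y j (resolutionHom g) z

variable (I : Ideal R) (j : ℕ) (N : ModuleCat.{0} R)

/-- The direct system defining `localCohomology`, evaluated at a module. -/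
abbrev evalDiagram : ℕᵒᵖᵒᵖ ⥤ ModuleCat.{0} R :=
  localCohomology.diagram (localCohomology.idealPowersDiagram I) j ⋙
    (evaluation (ModuleCat.{0} R) (ModuleCat.{0} R)).obj N

/-- The colimit cocone defining `localCohomology`, evaluated at a module. -/
abbrev evalCocone : Cocone (evalDiagram I j N) :=
  ((evaluation (ModuleCat.{0} R) (ModuleCat.{0} R)).obj N).mapCocone
    (colimit.cocone (localCohomology.diagram (localCohomology.idealPowersDiagram I) j))

/-- The cocone `evalCocone` is colimiting. -/
def evalCoconeIsColimit : IsColimit (evalCocone I j N) :=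
  isColimitOfPreserves _ (colimit.isColimit _)

/-- The component of `evalCocone` at a power of the ideal. -/
def powToLocalCohomology (n : ℕ) : PowExt I j N n →ₗ[R] (localCohomology I j).obj N :=
  ((evalCocone I j N).ι.app (op (op n))).hom ∘ₗ
    (extEquiv (ModuleCat.of R (R ⧸ I ^ n)) N j).symm.toLinearMap

lemma extEquiv_evalDiagram_map {n m : ℕ} (f : op (op n) ⟶ op (op m))
    (x : (evalDiagram I j N).obj (op (op n))) :
    extEquiv (ModuleCat.of R (R ⧸ I ^ m)) N j ((evalDiagram I j N).map f x) =
      powExtMap I j N n m f.unop.unop.down.down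
        (extEquiv (ModuleCat.of R (R ⧸ I ^ n)) N j x) :=
  extEquiv_map (powQuot I f.unop.unop.down.down) N j x

/-- The comparison map between the two models of local cohomology. -/
def toLocalCohomology : LocCoh I j N →ₗ[R] (localCohomology I j).obj N :=
  Module.DirectLimit.lift R ℕ (PowExt I j N) (powExtMap I j N) (powToLocalCohomology I j N)
    fun n m h x => by
      have h1 := extEquiv_evalDiagram_map I j N (homOfLE h).op.op
        ((extEquiv (ModuleCat.of R (R ⧸ I ^ n)) N j).symm x)
      rw [LinearEquiv.apply_symm_apply] at h1
      have h3 := (LinearEquiv.eq_symm_apply (extEquiv (ModuleCat.of R (R ⧸ I ^ m)) N j)).2 h1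
      have h2 := congrArg (fun g => g.hom
        ((extEquiv (ModuleCat.of R (R ⧸ I ^ n)) N j).symm x))
        ((evalCocone I j N).w (homOfLE h).op.op)
      exact (congrArg ((evalCocone I j N).ι.app (op (op m))).hom h3.symm).trans h2

lemma toLocalCohomology_of (n : ℕ) (x : PowExt I j N n) :
    toLocalCohomology I j N (LocCoh.of I j N n x) = powToLocalCohomology I j N n x :=
  Module.DirectLimit.lift_of ..

lemma toLocalCohomology_surjective : Function.Surjective (toLocalCohomology I j N) := by
  intro z
  obtain ⟨⟨⟨n⟩⟩, x, hx⟩ := Concrete.isColimit_exists_rep _ (evalCoconeIsColimit I j N) z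
  refine ⟨LocCoh.of I j N n (extEquiv (ModuleCat.of R (R ⧸ I ^ n)) N j x), ?_⟩
  rw [toLocalCohomology_of, ← hx]
  exact congrArg ((evalCocone I j N).ι.app (op (op n))).hom (LinearEquiv.symm_apply_apply _ x)

lemma toLocalCohomology_injective : Function.Injective (toLocalCohomology I j N) := by
  refine (injective_iff_map_eq_zero _).2 fun z hz => ?_
  obtain ⟨n, x, rfl⟩ := LocCoh.exists_of z
  rw [toLocalCohomology_of] at hz
  obtain ⟨⟨⟨m⟩⟩, f, g, h⟩ := Concrete.isColimit_exists_of_rep_eq (evalDiagram I j N)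
    (i := op (op n)) (j := op (op n)) (evalCoconeIsColimit I j N)
    ((extEquiv (ModuleCat.of R (R ⧸ I ^ n)) N j).symm x) 0 (hz.trans (map_zero _).symm)
  have h1 := extEquiv_evalDiagram_map I j N f
    ((extEquiv (ModuleCat.of R (R ⧸ I ^ n)) N j).symm x)
  rw [LinearEquiv.apply_symm_apply] at h1
  refine (LocCoh.of_eq_zero_iff x).2 ⟨m, f.unop.unop.down.down, h1.symm.trans ?_⟩
  rw [h]
  exact (congrArg (extEquiv (ModuleCat.of R (R ⧸ I ^ m)) N j) (map_zero _)).trans (map_zero _)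

/-- Local cohomology as a direct limit of extension modules agrees with `localCohomology`. -/
def locCohEquiv : LocCoh I j N ≃ₗ[R] (localCohomology I j).obj N :=
  LinearEquiv.ofBijective (toLocalCohomology I j N)
    ⟨toLocalCohomology_injective I j N, toLocalCohomology_surjective I j N⟩

end Comparison

section Transfer

section Subquotient

variable {N N' P : Type} [AddCommGroup N] [Module R N] [AddCommGroup N'] [Module R N']
  [AddCommGroup P] [Module R P]

lemma IsSubquotient.of_span {S : Type} [AddCommGroup S] [Module R S] (ι : S →ₗ[R] P)
    (hι : Function.Injective ι) (g : S →ₗ[R] N) (hg : Function.Surjective g) :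
    IsSubquotient (R := R) N P :=
  ⟨LinearMap.range ι, LinearMap.ker (g ∘ₗ (LinearEquiv.ofInjective ι hι).symm.toLinearMap),
    ⟨LinearMap.quotKerEquivOfSurjective _
      (hg.comp (LinearEquiv.ofInjective ι hι).symm.surjective)⟩⟩

lemma IsSubquotient.refl : IsSubquotient (R := R) P P :=
  .of_span LinearMap.id Function.injective_id LinearMap.id Function.surjective_id

lemma IsSubquotient.of_surjective (h : IsSubquotient (R := R) N' P) (φ : N' →ₗ[R] N)
    (hφ : Function.Surjective φ) : IsSubquotient (R := R) N P := by
  obtain ⟨Q, Q', ⟨e⟩⟩ := h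
  exact .of_span Q.subtype Q.subtype_injective (φ ∘ₗ e.toLinearMap ∘ₗ Q'.mkQ)
    (hφ.comp (e.surjective.comp Q'.mkQ_surjective))

lemma IsSubquotient.of_injective (h : IsSubquotient (R := R) N' P) (φ : N →ₗ[R] N')
    (hφ : Function.Injective φ) : IsSubquotient (R := R) N P := by
  obtain ⟨Q, Q', ⟨e⟩⟩ := h
  let g : Q →ₗ[R] N' := e.toLinearMap ∘ₗ Q'.mkQ
  have hg : Function.Surjective g := e.surjective.comp Q'.mkQ_surjective
  refine .of_span (S := (LinearMap.range φ).comap g) (Q.subtype ∘ₗ Submodule.subtype _)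
    (Q.subtype_injective.comp (Submodule.subtype_injective _))
    ((LinearEquiv.ofInjective φ hφ).symm.toLinearMap ∘ₗ
      g.restrict (p := (LinearMap.range φ).comap g) (q := LinearMap.range φ) fun _ h => h) ?_
  refine (LinearEquiv.ofInjective φ hφ).symm.surjective.comp ?_
  rintro ⟨z, hz⟩
  obtain ⟨x, rfl⟩ := hg z
  exact ⟨⟨x, hz⟩, rfl⟩

lemma IsSubquotient.trans_injective {P' : Type} [AddCommGroup P'] [Module R P']
    (h : IsSubquotient (R := R) N P) (φ : P →ₗ[R] P') (hφ : Function.Injective φ) :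
    IsSubquotient (R := R) N P' := by
  obtain ⟨Q, Q', ⟨e⟩⟩ := h
  exact .of_span (φ ∘ₗ Q.subtype) (hφ.comp Q.subtype_injective) (e.toLinearMap ∘ₗ Q'.mkQ)
    (e.surjective.comp Q'.mkQ_surjective)

end Subquotient

section Component

variable {A B : Type} [AddCommGroup A] [AddCommGroup B] (𝒜 : ℤ → AddSubgroup A)
  (ℬ : ℤ → AddSubgroup B) [DirectSum.Decomposition 𝒜] [DirectSum.Decomposition ℬ]

/-- The homogeneous component of degree `ℓ`. -/
def component (ℓ : ℤ) : A →+ A :=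
  (𝒜 ℓ).subtype.comp ((DFinsupp.evalAddMonoidHom ℓ).comp
    (DirectSum.decomposeAddEquiv 𝒜).toAddMonoidHom)

lemma component_apply (ℓ : ℤ) (x : A) :
    component 𝒜 ℓ x = (DirectSum.decompose 𝒜 x ℓ : A) := rfl

lemma component_mem (ℓ : ℤ) (x : A) : component 𝒜 ℓ x ∈ 𝒜 ℓ := SetLike.coe_mem _

lemma component_eq_self (ℓ : ℤ) (x : A) (hx : x ∈ 𝒜 ℓ) : component 𝒜 ℓ x = x :=
  DirectSum.decompose_of_mem_same 𝒜 hx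

variable {𝒜 ℬ}

/-- An additive map that is homogeneous of degree `a` shifts homogeneous components by `a`. -/
lemma component_map (f : A →+ B) (a : ℤ) (hf : ∀ ℓ, ∀ x ∈ 𝒜 ℓ, f x ∈ ℬ (ℓ + a)) (ℓ : ℤ)
    (x : A) : component ℬ (ℓ + a) (f x) = f (component 𝒜 ℓ x) := by
  induction x using DirectSum.Decomposition.inductionOn 𝒜 with
  | zero => simp
  | homogeneous x =>
    rename_i m
    by_cases h : m = ℓ
    · subst h
      rw [component_eq_self _ _ _ x.2, component_eq_self _ _ _ (hf _ _ x.2)]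
    · rw [component_apply, component_apply,
        DirectSum.decompose_of_mem_ne 𝒜 x.2 h, map_zero,
        DirectSum.decompose_of_mem_ne ℬ (hf _ _ x.2) (by omega)]
  | add x y hx hy => rw [map_add, map_add, map_add, map_add, hx, hy]

end Component

section Graded

variable {A B C : Type} [AddCommGroup A] [Module R A] [AddCommGroup B] [Module R B]
  [AddCommGroup C] [Module R C]

lemma isProjections_component (𝒜 : ℤ → AddSubgroup R) {e : Fin n → ℤ}
    (he : ∀ a, y a ∈ 𝒜 (e a)) (ℬ : ℤ → AddSubgroup B) [DirectSum.Decomposition ℬ]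
    [SetLike.GradedSMul 𝒜 ℬ] : IsProjections y e ℬ (component ℬ) where
  mem := component_mem ℬ
  eq_self := component_eq_self ℬ
  smul a ℓ x := component_map (DistribSMul.toAddMonoidHom B (y a)) (e a)
    (fun m x hx => by
      have := SetLike.GradedSMul.smul_mem (he a) hx
      rwa [vadd_eq_add, add_comm] at this) ℓ x

variable {y} {e : Fin n → ℤ}

/-- The restriction to a submodule of a family of projections preserving it. -/
def restrictProj (p : ℤ → B →+ B) (S : Submodule R B) (hS : ∀ ℓ, ∀ x ∈ S, p ℓ x ∈ S) (ℓ : ℤ) :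
    S →+ S where
  toFun x := ⟨p ℓ x, hS ℓ x x.2⟩
  map_zero' := Subtype.ext (map_zero _)
  map_add' _ _ := Subtype.ext (map_add _ _ _)

/-- The grading induced on a submodule. -/
abbrev subGrading (ℬ : ℤ → AddSubgroup B) (S : Submodule R B) (ℓ : ℤ) : AddSubgroup S :=
  (ℬ ℓ).comap S.subtype.toAddMonoidHom

lemma IsProjections.restrict {ℬ : ℤ → AddSubgroup B} {p : ℤ → B →+ B}
    (hp : IsProjections y e ℬ p) (S : Submodule R B) (hS : ∀ ℓ, ∀ x ∈ S, p ℓ x ∈ S) :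
    IsProjections y e (subGrading ℬ S) (restrictProj p S hS) where
  mem ℓ x := hp.mem ℓ x
  eq_self ℓ x hx := Subtype.ext (hp.eq_self ℓ x hx)
  smul a ℓ x := Subtype.ext (hp.smul a ℓ x)

variable (y e) in
/-- A short exact sequence compatible with gradings. -/
structure IsGradedExact (f : A →ₗ[R] B) (g : B →ₗ[R] C) (𝒜 : ℤ → AddSubgroup A)
    (ℬ : ℤ → AddSubgroup B) (𝒞 : ℤ → AddSubgroup C) (pA : ℤ → A →+ A) (pB : ℤ → B →+ B) :
    Prop where
  injective : Function.Injective f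
  surjective : Function.Surjective g
  exact : Function.Exact f g
  left : IsProjections y e 𝒜 pA
  middle : IsProjections y e ℬ pB
  comm : ∀ ℓ x, f (pA ℓ x) = pB ℓ (f x)
  lift : ∀ ℓ, ∀ z ∈ 𝒞 ℓ, ∃ x ∈ ℬ ℓ, g x = z

lemma IsGradedExact.map_mem_iff {f : A →ₗ[R] B} {g : B →ₗ[R] C} {𝒜 : ℤ → AddSubgroup A}
    {ℬ : ℤ → AddSubgroup B} {𝒞 : ℤ → AddSubgroup C} {pA : ℤ → A →+ A} {pB : ℤ → B →+ B}
    (h : IsGradedExact y e f g 𝒜 ℬ 𝒞 pA pB) (ℓ : ℤ) (x : A) : f x ∈ ℬ ℓ ↔ x ∈ 𝒜 ℓ := by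
  constructor
  · intro hx
    have h1 := h.middle.eq_self _ _ hx
    rw [← h.comm] at h1
    exact h.injective h1 ▸ h.left.mem _ _
  · intro hx
    rw [← h.left.eq_self _ _ hx, h.comm]
    exact h.middle.mem _ _

lemma exists_homogeneous_lift {g : B →ₗ[R] C} {ℬ : ℤ → AddSubgroup B} {𝒞 : ℤ → AddSubgroup C}
    {pB : ℤ → B →+ B} {pC : ℤ → C →+ C} (hB : IsProjections y e ℬ pB)
    (hC : IsProjections y e 𝒞 pC) (hg : Function.Surjective g)
    (hp : ∀ ℓ x, pC ℓ (g x) = g (pB ℓ x)) (ℓ : ℤ) (z : C) (hz : z ∈ 𝒞 ℓ) :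
    ∃ x ∈ ℬ ℓ, g x = z := by
  obtain ⟨x, rfl⟩ := hg z
  exact ⟨pB ℓ x, hB.mem _ _, by rw [← hp, hC.eq_self _ _ hz]⟩

/-- The kernel of a graded surjection. -/
lemma isGradedExact_ker {g : B →ₗ[R] C} {ℬ : ℤ → AddSubgroup B} {𝒞 : ℤ → AddSubgroup C}
    {pB : ℤ → B →+ B} {pC : ℤ → C →+ C} (hB : IsProjections y e ℬ pB)
    (hC : IsProjections y e 𝒞 pC) (hg : Function.Surjective g)
    (hp : ∀ ℓ x, pC ℓ (g x) = g (pB ℓ x)) {S : Submodule R B} (hSg : LinearMap.ker g = S)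
    (hS : ∀ ℓ, ∀ x ∈ S, pB ℓ x ∈ S) :
    IsGradedExact y e S.subtype g (subGrading ℬ S) ℬ 𝒞 (restrictProj pB S hS) pB where
  injective := S.subtype_injective
  surjective := hg
  exact := by rw [LinearMap.exact_iff, hSg, Submodule.range_subtype]
  left := hB.restrict S hS
  middle := hB
  comm _ _ := rfl
  lift := exists_homogeneous_lift hB hC hg hp

/-- The quotient of two graded submodules, with trivial grading on the quotient. -/
lemma isGradedExact_inclusion {ℬ : ℤ → AddSubgroup B} {p : ℤ → B →+ B}
    (hB : IsProjections y e ℬ p) {S T : Submodule R B} (hST : S ≤ T)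
    (hS : ∀ ℓ, ∀ x ∈ S, p ℓ x ∈ S) (hT : ∀ ℓ, ∀ x ∈ T, p ℓ x ∈ T) :
    IsGradedExact y e (Submodule.inclusion hST) (S.comap T.subtype).mkQ (subGrading ℬ S)
      (subGrading ℬ T) (fun _ => ⊥) (restrictProj p S hS) (restrictProj p T hT) where
  injective := Submodule.inclusion_injective hST
  surjective := Submodule.mkQ_surjective _
  exact := by
    rw [LinearMap.exact_iff, Submodule.ker_mkQ, Submodule.range_inclusion]
  left := hB.restrict S hS
  middle := hB.restrict T hT
  comm _ _ := rfl
  lift _ z hz := ⟨0, zero_mem _, by rw [map_zero, (AddSubgroup.mem_bot.1 hz)]⟩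

end Graded

/-- A property of graded modules in cohomological degrees that can be transferred along the long
exact sequences in which a third term vanishes. -/
structure IsTransfer (e : Fin n → ℤ) (V : ℕ → (N : Type) → [AddCommGroup N] → [Module R N] → Prop)
    (G : ℕ → (N : Type) → [AddCommGroup N] → [Module R N] → (ℤ → AddSubgroup N) → Prop) :
    Prop where
  of_middle : ∀ {A B C : Type} [AddCommGroup A] [Module R A] [AddCommGroup B] [Module R B]
    [AddCommGroup C] [Module R C] {f : A →ₗ[R] B} {g : B →ₗ[R] C} {𝒜 : ℤ → AddSubgroup A}
    {ℬ : ℤ → AddSubgroup B} {𝒞 : ℤ → AddSubgroup C} {pA : ℤ → A →+ A} {pB : ℤ → B →+ B} {j : ℕ},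
    IsGradedExact y e f g 𝒜 ℬ 𝒞 pA pB → V j B → G (j + 1) A 𝒜 → G j C 𝒞
  of_quotient : ∀ {A B C : Type} [AddCommGroup A] [Module R A] [AddCommGroup B] [Module R B]
    [AddCommGroup C] [Module R C] {f : A →ₗ[R] B} {g : B →ₗ[R] C} {𝒜 : ℤ → AddSubgroup A}
    {ℬ : ℤ → AddSubgroup B} {𝒞 : ℤ → AddSubgroup C} {pA : ℤ → A →+ A} {pB : ℤ → B →+ B} {j : ℕ},
    IsGradedExact y e f g 𝒜 ℬ 𝒞 pA pB → V j C → G j A 𝒜 → G j B ℬ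
  of_sub : ∀ {A B C : Type} [AddCommGroup A] [Module R A] [AddCommGroup B] [Module R B]
    [AddCommGroup C] [Module R C] {f : A →ₗ[R] B} {g : B →ₗ[R] C} {𝒜 : ℤ → AddSubgroup A}
    {ℬ : ℤ → AddSubgroup B} {𝒞 : ℤ → AddSubgroup C} {pA : ℤ → A →+ A} {pB : ℤ → B →+ B} {j : ℕ},
    IsGradedExact y e f g 𝒜 ℬ 𝒞 pA pB → V (j + 1) A → G j B ℬ → G j C 𝒞

lemma isTransfer_kVanish (e : Fin n → ℤ) (ℓ : ℤ) :
    IsTransfer y e (fun j N _ _ => KVanishAll y j N) (fun j _ _ _ 𝒩 => KVanish y 𝒩 e j ℓ) where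
  of_middle h hv hA := KVanish.of_middle h.injective h.exact h.middle
    (fun _ _ => (h.map_mem_iff _ _).1) h.lift hv hA
  of_quotient h hv hA := KVanish.of_quotient h.injective h.surjective h.exact h.middle
    (fun _ _ => (h.map_mem_iff _ _).1) h.comm hv hA
  of_sub h hv hB := KVanish.of_sub h.injective h.exact h.left h.middle h.map_mem_iff h.lift hv hB

section LocCoh

variable {P : Type} [AddCommGroup P] [Module R P] {I : Ideal R} {j : ℕ}

section ShortComplex

variable {S : ShortComplex (ModuleCat.{0} R)} (hS : S.ShortExact) {X₁ X₂ X₃ : ModuleCat.{0} R}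
  (h₁ : S.X₁ = X₁) (h₂ : S.X₂ = X₂) (h₃ : S.X₃ = X₃)
include hS h₁ h₂ h₃

lemma IsSubquotient.locCoh_X₃_of_X₁ (hv : Subsingleton (LocCoh I j X₂))
    (h : IsSubquotient (R := R) (LocCoh I (j + 1) X₁) P) :
    IsSubquotient (R := R) (LocCoh I j X₃) P := by
  subst h₁ h₂ h₃
  exact h.of_injective _ (LocCoh.post_injective hS j)

lemma IsSubquotient.locCoh_X₂_of_X₁ (hv : Subsingleton (LocCoh I j X₃))
    (h : IsSubquotient (R := R) (LocCoh I j X₁) P) :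
    IsSubquotient (R := R) (LocCoh I j X₂) P := by
  subst h₁ h₂ h₃
  exact h.of_surjective _ (LocCoh.post_f_surjective hS j)

lemma IsSubquotient.locCoh_X₃_of_X₂ (hv : Subsingleton (LocCoh I (j + 1) X₁))
    (h : IsSubquotient (R := R) (LocCoh I j X₂) P) :
    IsSubquotient (R := R) (LocCoh I j X₃) P := by
  subst h₁ h₂ h₃
  exact h.of_surjective _ (LocCoh.post_g_surjective hS j)

end ShortComplex

lemma isTransfer_isSubquotient (e : Fin n → ℤ) (I : Ideal R) (P : Type) [AddCommGroup P]
    [Module R P] :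
    IsTransfer y e (fun j N _ _ => Subsingleton (LocCoh I j (ModuleCat.of R N)))
      (fun j N _ _ _ => IsSubquotient (R := R) (LocCoh I j (ModuleCat.of R N)) P) where
  of_middle h hv hA := .locCoh_X₃_of_X₁
    (sesOf_shortExact h.exact h.injective h.surjective) rfl rfl rfl hv hA
  of_quotient h hv hA := .locCoh_X₂_of_X₁
    (sesOf_shortExact h.exact h.injective h.surjective) rfl rfl rfl hv hA
  of_sub h hv hB := .locCoh_X₃_of_X₂
    (sesOf_shortExact h.exact h.injective h.surjective) rfl rfl rfl hv hB

end LocCoh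

end Transfer

section Chase

variable {y} {e : Fin n → ℤ}
  {V : ℕ → (N : Type) → [AddCommGroup N] → [Module R N] → Prop}
  {G : ℕ → (N : Type) → [AddCommGroup N] → [Module R N] → (ℤ → AddSubgroup N) → Prop}

/-- Passing from the end of a homogeneous complex to its zeroth homology. -/
lemma IsTransfer.of_complex [IsNoetherianRing R] (hG : IsTransfer y e V G) {I : Ideal R}
    (hV : IsVanishing I V) {d : ℕ} (hdim : ringKrullDim R = (d : WithBot (WithTop ℕ)))
    {ℳ : ℤ → AddSubgroup M} {pM : ℤ → M →+ M} (hpM : IsProjections y e ℳ pM)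
    {C : ℕ → Type} [∀ j, AddCommGroup (C j)] [∀ j, Module R (C j)]
    [∀ j, Module.Finite R (C j)] {dl : ∀ j, C (j + 1) →ₗ[R] C j}
    (hcomplex : ∀ j, (dl j).comp (dl (j + 1)) = 0)
    {𝒞 : ∀ j, ℤ → AddSubgroup (C j)} {pC : ∀ j, ℤ → C j →+ C j}
    (hpC : ∀ j, IsProjections y e (𝒞 j) (pC j))
    (hdl : ∀ j ℓ x, pC j ℓ (dl j x) = dl j (pC (j + 1) ℓ x))
    {π : C 0 →ₗ[R] M} (hπsurj : Function.Surjective π)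
    (hπker : LinearMap.ker π = LinearMap.range (dl 0))
    (hπ : ∀ ℓ x, pM ℓ (π x) = π (pC 0 ℓ x)) {i m : ℕ} (him : i + m = d)
    (hdepth : ∀ j < m, depthGE I (C j) (i + j + 1))
    (hHdim : ∀ j, modDimLE (R := R) (Hmod C dl j) ((j + 1) + i))
    (h : G d (C m) (𝒞 m)) : G i M ℳ := by
  have hrange : ∀ k ℓ, ∀ x ∈ LinearMap.range (dl k), pC k ℓ x ∈ LinearMap.range (dl k) := by
    rintro k ℓ _ ⟨x, rfl⟩
    exact ⟨_, (hdl k ℓ x).symm⟩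
  have hker : ∀ k ℓ, ∀ x ∈ LinearMap.ker (dl k), pC (k + 1) ℓ x ∈ LinearMap.ker (dl k) := by
    intro k ℓ x hx
    rw [LinearMap.mem_ker] at hx ⊢
    rw [← hdl, hx, map_zero]
  have hπ' := isGradedExact_ker (hpC 0) hpM hπsurj hπ hπker (hrange 0)
  have hdl' : ∀ k, IsGradedExact y e (LinearMap.ker (dl k)).subtype (dl k).rangeRestrict
      (subGrading (𝒞 (k + 1)) (LinearMap.ker (dl k))) (𝒞 (k + 1))
      (subGrading (𝒞 k) (LinearMap.range (dl k)))
      (restrictProj (pC (k + 1)) _ (hker k)) (pC (k + 1)) := fun k =>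
    isGradedExact_ker (hpC (k + 1)) ((hpC k).restrict _ (hrange k))
      (dl k).surjective_rangeRestrict (fun ℓ x => Subtype.ext (hdl k ℓ x))
      (dl k).ker_rangeRestrict (hker k)
  cases m with
  | zero =>
    obtain rfl : i = d := him
    exact hG.of_sub hπ' (hV.of_ringKrullDim_lt _ hdim (Nat.lt_succ_self _)) h
  | succ m =>
    have key : ∀ k ≤ m, G (i + k + 1) (LinearMap.range (dl k))
        (subGrading (𝒞 k) (LinearMap.range (dl k))) := by
      intro k hk
      induction hk using Nat.decreasingInduction with
      | self =>
        obtain rfl : i + m + 1 = d := him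
        exact hG.of_sub (hdl' m) (hV.of_ringKrullDim_lt _ hdim (Nat.lt_succ_self _)) h
      | of_succ k hk ih =>
        refine hG.of_middle (hdl' k)
          (hV.of_depthGE _ (hdepth (k + 1) (by omega)) (by omega)) ?_
        exact hG.of_quotient (isGradedExact_inclusion (hpC (k + 1))
          (LinearMap.range_le_ker_iff.2 (hcomplex k)) (hrange (k + 1)) (hker k))
          (hV.of_modDimLE (Hmod C dl k) (hHdim k) (by omega)) ih
    exact hG.of_middle hπ' (hV.of_depthGE _ (hdepth 0 (by omega)) (by omega)) (key 0 (by omega))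

end Chase

section Free

variable {y} {e : Fin n → ℤ}

/-- The grading of a free module on generators of the given degrees. -/
abbrev freeGrading (𝒜 : ℤ → AddSubgroup R) {s : Type} (b : s → ℤ) (ℓ : ℤ) :
    AddSubgroup (s → R) :=
  AddSubgroup.pi Set.univ fun k => 𝒜 (ℓ - b k)

lemma KVanish.free {𝒜 : ℤ → AddSubgroup R} {s : Type} [Fintype s] {b : s → ℤ} {j : ℕ} {ℓ : ℤ}
    (h : ∀ k, KVanish y 𝒜 e j (ℓ - b k)) : KVanish y (freeGrading 𝒜 b) e j ℓ := by
  intro t f hf hfh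
  have h1 : ∀ k, ∃ u, IsKBoundary y (t + u) j (kTrans y u j fun S => f S k) := fun k =>
    h k t _ (by
      have := kd_map y (LinearMap.proj k : (s → R) →ₗ[R] R) t j f
      rw [hf] at this
      exact this) (fun S => by
      have h0 : f S k ∈ 𝒜 (ℓ + (t : ℤ) * ∑ j ∈ S.1, e j - b k) := hfh S k trivial
      rwa [add_sub_right_comm] at h0)
  choose u hu using h1
  have h2 : ∀ k, IsKBoundary y (t + ∑ k, u k) j (kTrans y (∑ k, u k) j fun S => f S k) := by
    intro k
    have h3 := (hu k).kTrans (∑ k, u k - u k)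
    have h4 : u k ≤ ∑ k, u k := Finset.single_le_sum (fun _ _ => Nat.zero_le _) (Finset.mem_univ k)
    rwa [kTrans_kTrans, add_assoc, Nat.add_sub_cancel' h4] at h3
  refine ⟨∑ k, u k, ?_⟩
  cases j with
  | zero =>
    funext S k
    exact congrFun (h2 k) S
  | succ j =>
    choose v hv using h2
    refine ⟨fun S k => v k S, ?_⟩
    funext S k
    have h3 := kd_map y (LinearMap.proj k : (s → R) →ₗ[R] R) (t + ∑ k, u k) j fun S k => v k S
    exact (congrFun h3 S).symm.trans (congrFun (hv k) S)

/-- The projections of a free module on generators of the given degrees. -/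
def freeProj (𝒜 : ℤ → AddSubgroup R) [GradedRing 𝒜] {s : Type} (b : s → ℤ) (ℓ : ℤ) :
    (s → R) →+ (s → R) where
  toFun v k := component 𝒜 (ℓ - b k) (v k)
  map_zero' := by
    funext k
    simp
  map_add' v w := by
    funext k
    simp

lemma isProjections_freeProj {𝒜 : ℤ → AddSubgroup R} [GradedRing 𝒜] (he : ∀ a, y a ∈ 𝒜 (e a))
    {s : Type} (b : s → ℤ) : IsProjections y e (freeGrading 𝒜 b) (freeProj 𝒜 b) where
  mem ℓ v k _ := component_mem _ _ _
  eq_self ℓ v hv := by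
    funext k
    exact component_eq_self _ _ _ (hv k trivial)
  smul a ℓ v := by
    funext k
    have h := (isProjections_component y 𝒜 he 𝒜).smul a (ℓ - b k) (v k)
    rw [← add_sub_right_comm] at h
    exact h

lemma KVanish.of_genDegLE [IsNoetherianRing R] {𝒜 : ℤ → AddSubgroup R} [GradedRing 𝒜]
    (he : ∀ a, y a ∈ 𝒜 (e a)) {d : ℕ} (hv : ∀ (N : Type) [AddCommGroup N] [Module R N],
      Module.Finite R N → KVanishAll y (d + 1) N)
    [Module.Finite R M] (ℳ : ℤ → AddSubgroup M) [DirectSum.Decomposition ℳ]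
    [SetLike.GradedSMul 𝒜 ℳ] {β γ : ℤ} (hβ : GenDegLE (R := R) ℳ β)
    (hγ : ∀ ℓ : ℤ, γ < ℓ → KVanish y 𝒜 e d ℓ) {ℓ : ℤ} (hℓ : β + γ < ℓ) : KVanish y ℳ e d ℓ := by
  have hfg : (Submodule.span R (⋃ (j : ℤ) (_ : j ≤ β), (ℳ j : Set M))).FG := by
    rw [hβ]
    exact Module.Finite.fg_top
  obtain ⟨s, hs, hspan⟩ := (Submodule.fg_span_iff_fg_span_finset_subset _).1 hfg
  rw [hβ] at hspan
  have hdeg : ∀ x : s, ∃ b : ℤ, b ≤ β ∧ (x : M) ∈ ℳ b := fun x => by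
    simpa using hs x.2
  choose b hb hxb using hdeg
  let g : (s → R) →ₗ[R] M := Fintype.linearCombination R (fun x : s => (x : M))
  have hg : Function.Surjective g := by
    rw [← LinearMap.range_eq_top, Fintype.range_linearCombination, Subtype.range_coe_subtype]
    exact hspan.symm
  have hp : ∀ ℓ v, component ℳ ℓ (g v) = g (freeProj 𝒜 b ℓ v) := by
    intro ℓ v
    simp only [g, Fintype.linearCombination_apply, map_sum]
    refine Finset.sum_congr rfl fun x _ => ?_
    have h := component_map (𝒜 := 𝒜) (ℬ := ℳ)
      ((LinearMap.toSpanSingleton R M (x : M)).toAddMonoidHom) (b x)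
      (fun m r hr => SetLike.GradedSMul.smul_mem hr (hxb x)) (ℓ - b x) (v x)
    rw [sub_add_cancel] at h
    exact h
  have hker : ∀ ℓ, ∀ v ∈ LinearMap.ker g, freeProj 𝒜 b ℓ v ∈ LinearMap.ker g := by
    intro ℓ v hv
    rw [LinearMap.mem_ker] at hv ⊢
    rw [← hp, hv, map_zero]
  refine (isTransfer_kVanish y e ℓ).of_sub (isGradedExact_ker (isProjections_freeProj he b)
    (isProjections_component y 𝒜 he ℳ) hg hp rfl hker) (hv _ inferInstance) ?_
  exact KVanish.free fun k => hγ _ (by linarith [hb k])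

end Free
theorem statement0
    (𝒜 : ℤ → AddSubgroup R) [GradedRing 𝒜]
    -- `R` is Noetherian, non-negatively graded, with local degree-zero part `R₀ = 𝒜 0`
    (hNoeth : IsNoetherianRing R)
    (hnonneg : ∀ i : ℤ, i < 0 → 𝒜 i = ⊥)
    (hloc : IsLocalRing ↥(𝒜 0))
    -- `dim R = d`
    (d : ℕ) (hdim : ringKrullDim R = (d : WithBot (WithTop ℕ)))
    -- `M` is a graded `R`-module
    (M : Type) [AddCommGroup M] [Module R M]
    (ℳ : ℤ → AddSubgroup M) [DirectSum.Decomposition ℳ] [SetLike.GradedSMul 𝒜 ℳ]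
    -- `C_•` is a homogeneous complex of finitely generated graded `R`-modules
    (C : ℕ → Type) [∀ j, AddCommGroup (C j)] [∀ j, Module R (C j)]
    (hCfin : ∀ j, Module.Finite R (C j))
    (dl : ∀ j, C (j + 1) →ₗ[R] C j)
    (hcomplex : ∀ j, (dl j).comp (dl (j + 1)) = 0)
    (𝒞 : ∀ j, ℤ → AddSubgroup (C j))
    [∀ j, DirectSum.Decomposition (𝒞 j)] [∀ j, SetLike.GradedSMul 𝒜 (𝒞 j)]
    (hdlhomog : ∀ (j : ℕ) (ℓ : ℤ), ∀ x ∈ 𝒞 (j + 1) ℓ, dl j x ∈ 𝒞 j ℓ)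
    -- `H₀(C_•) = M`, via a homogeneous surjection `π : C₀ → M` with kernel `im ∂₁`
    (π : C 0 →ₗ[R] M) (hπsurj : Function.Surjective π)
    (hπker : LinearMap.ker π = LinearMap.range (dl 0))
    (hπhomog : ∀ (ℓ : ℤ), ∀ x ∈ 𝒞 0 ℓ, π x ∈ ℳ ℓ)
    -- the fixed cohomological index `i`, `0 ≤ i ≤ d`
    (i : ℕ) (hi : i ≤ d)
    -- hypothesis (a): `i + j + 1 ≤ depth C_j` for `0 ≤ j ≤ d - i - 1`
    (hdepth : ∀ j : ℕ, (j : ℤ) ≤ (d : ℤ) - (i : ℤ) - 1 →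
      depthGE (maxHomIdeal 𝒜) (C j) (i + j + 1))
    -- hypothesis (b): `dim H_j(C_•) ≤ j + i` for all `j ≥ 1`
    (hHdim : ∀ jm1 : ℕ, modDimLE (R := R) (Hmod C dl jm1) ((jm1 + 1) + i)) :
    -- conclusion (1): `H^i_𝔪(M)` is a subquotient of `H^d_𝔪(C_{d-i})`
    IsSubquotient (R := R)
      ((localCohomology (maxHomIdeal 𝒜) i).obj (ModuleCat.of R M))
      ((localCohomology (maxHomIdeal 𝒜) d).obj (ModuleCat.of R (C (d - i))))
    -- conclusion (2): `a_i(M) ≤ b₀(C_{d-i}) + a(R)`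
    ∧ (∀ (m : ℕ) (y : Fin m → R) (e : Fin m → ℤ),
        (∀ j, y j ∈ 𝒜 (e j)) →
        (Ideal.span (Set.range y)).radical = (maxHomIdeal 𝒜).radical →
        ∀ β γ : ℤ, GenDegLE (R := R) (𝒞 (d - i)) β →
          (∀ ℓ : ℤ, γ < ℓ → KVanish y (fun j => 𝒜 j) e d ℓ) →
          (∀ ℓ : ℤ, β + γ < ℓ → KVanish y ℳ e i ℓ)) := by
  have := hNoeth
  have := hCfin
  have him : i + (d - i) = d := Nat.add_sub_cancel' hi
  have hdl : ∀ j ℓ x, component (𝒞 j) ℓ (dl j x) = dl j (component (𝒞 (j + 1)) ℓ x) := by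
    intro j ℓ x
    have h := component_map (𝒜 := 𝒞 (j + 1)) (ℬ := 𝒞 j) (dl j).toAddMonoidHom 0
      (fun m x hx => by rw [add_zero]; exact hdlhomog j m x hx) ℓ x
    rwa [add_zero] at h
  have hπ : ∀ ℓ x, component ℳ ℓ (π x) = π (component (𝒞 0) ℓ x) := by
    intro ℓ x
    have h := component_map (𝒜 := 𝒞 0) (ℬ := ℳ) π.toAddMonoidHom 0
      (fun m x hx => by rw [add_zero]; exact hπhomog m x hx) ℓ x
    rwa [add_zero] at h
  have hdepth' : ∀ j < d - i, depthGE (maxHomIdeal 𝒜) (C j) (i + j + 1) := fun j hj =>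
    hdepth j (by omega)
  constructor
  · have h := (isTransfer_isSubquotient (R := R) (n := 0) Fin.elim0 Fin.elim0 (maxHomIdeal 𝒜)
      (LocCoh (maxHomIdeal 𝒜) d (ModuleCat.of R (C (d - i))))).of_complex isVanishing_locCoh hdim
      (isProjections_component Fin.elim0 𝒜 (fun a => a.elim0) ℳ) hcomplex
      (fun j => isProjections_component Fin.elim0 𝒜 (fun a => a.elim0) (𝒞 j)) hdl hπsurj hπker hπ
      him hdepth' hHdim IsSubquotient.refl
    exact (h.of_surjective (locCohEquiv _ _ _).toLinearMap
      (locCohEquiv _ _ _).surjective).trans_injective (locCohEquiv _ _ _).toLinearMap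
      (locCohEquiv _ _ _).injective
  · intro m y e he hrad β γ hβ hγ ℓ hℓ
    refine (isTransfer_kVanish y e ℓ).of_complex (isVanishing_kVanishAll hrad) hdim
      (isProjections_component y 𝒜 he ℳ) hcomplex
      (fun j => isProjections_component y 𝒜 he (𝒞 j)) hdl hπsurj hπker hπ him hdepth' hHdim ?_
    exact KVanish.of_genDegLE he (fun N _ _ _ =>
      (isVanishing_kVanishAll hrad).of_ringKrullDim_lt N hdim (Nat.lt_succ_self d))
      (𝒞 (d - i)) hβ hγ hℓ

end Paper
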